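/- Let X_1,…,X_n be independent identically distributed real random variables with mean μ, variance σ² > 0 and ρ = E|X_1 − μ|³ < ∞, and let X = X_1+…+X_n. Then P[σ√n ≤ X − μn ≤ 2σ√n] ≥ 1/8 − ρ/(σ³√n), and P[−2σ√n ≤ X − μn ≤ −σ√n] ≥ 1/8 − ρ/(σ³√n). -/

import Mathlib

open MeasureTheory ProbabilityTheory


lemma norm_exp_sub_one_sub (x : ℝ) (hx : 0 ≤ x) :
    ‖Complex.exp (Complex.I * x) - 1 - Complex.I * x‖ ≤ x ^ 2 / 2 := by
  have hd : ∀ y : ℝ, HasDerivAt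
      (fun y : ℝ => Complex.exp (Complex.I * y) - 1 - Complex.I * y)
      (Complex.I * (Complex.exp (Complex.I * y) - 1)) y := by
    intro y
    have h1 : HasDerivAt (fun y : ℝ => Complex.I * (y : ℂ)) Complex.I y := by
      simpa using (Complex.ofRealCLM.hasDerivAt (x := y)).const_mul Complex.I
    have h2 := ((h1.cexp).sub_const 1).sub h1
    exact h2.congr_deriv (by ring)
  have hB : ∀ y : ℝ, HasDerivAt (fun y : ℝ => y ^ 2 / 2) y y := by
    intro y
    have := ((hasDerivAt_id y).pow 2).div_const 2
    exact this.congr_deriv (by simp)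
  refine image_norm_le_of_norm_deriv_right_le_deriv_boundary
    (f := fun y : ℝ => Complex.exp (Complex.I * y) - 1 - Complex.I * y)
    (f' := fun y : ℝ => Complex.I * (Complex.exp (Complex.I * y) - 1))
    (B := fun y : ℝ => y ^ 2 / 2) (B' := fun y => y) (a := 0) (b := x)
    (fun y _ => (hd y).continuousAt.continuousWithinAt)
    (fun y _ => (hd y).hasDerivWithinAt) (by simp) hB ?_ ⟨hx, le_rfl⟩
  intro y hy
  rw [norm_mul, Complex.norm_I, one_mul]
  refine (Real.norm_exp_I_mul_ofReal_sub_one_le).trans ?_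
  rw [Real.norm_eq_abs, abs_of_nonneg hy.1]

lemma norm_exp_taylor3_nonneg (x : ℝ) (hx : 0 ≤ x) :
    ‖Complex.exp (Complex.I * x) - 1 - Complex.I * x + x ^ 2 / 2‖ ≤ x ^ 3 / 6 := by
  have hd : ∀ y : ℝ, HasDerivAt
      (fun y : ℝ => Complex.exp (Complex.I * y) - 1 - Complex.I * y + (y : ℂ) ^ 2 / 2)
      (Complex.I * (Complex.exp (Complex.I * y) - 1 - Complex.I * y)) y := by
    intro y
    have h0 : HasDerivAt (fun y : ℝ => (y : ℂ)) 1 y := by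
      simpa using (hasDerivAt_id y).ofReal_comp
    have h1 : HasDerivAt (fun y : ℝ => Complex.I * (y : ℂ)) Complex.I y := by
      simpa using h0.const_mul Complex.I
    have h2 := (((h1.cexp).sub_const 1).sub h1).add ((h0.pow 2).div_const 2)
    have : Complex.I * Complex.I = -1 := Complex.I_mul_I
    refine h2.congr_deriv ?_
    simp
    linear_combination (y : ℂ) * this
  have hB : ∀ y : ℝ, HasDerivAt (fun y : ℝ => y ^ 3 / 6) (y ^ 2 / 2) y := by
    intro y
    have := ((hasDerivAt_id y).pow 3).div_const 6
    exact this.congr_deriv (by simp; ring)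
  refine image_norm_le_of_norm_deriv_right_le_deriv_boundary
    (f := fun y : ℝ => Complex.exp (Complex.I * y) - 1 - Complex.I * y + (y : ℂ) ^ 2 / 2)
    (f' := fun y : ℝ => Complex.I * (Complex.exp (Complex.I * y) - 1 - Complex.I * y))
    (B := fun y : ℝ => y ^ 3 / 6) (B' := fun y => y ^ 2 / 2) (a := 0) (b := x)
    (fun y _ => (hd y).continuousAt.continuousWithinAt)
    (fun y _ => (hd y).hasDerivWithinAt) (by simp) hB ?_ ⟨hx, le_rfl⟩
  intro y hy
  rw [norm_mul, Complex.norm_I, one_mul]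
  exact norm_exp_sub_one_sub y hy.1

lemma norm_exp_taylor3 (x : ℝ) :
    ‖Complex.exp (Complex.I * x) - 1 - Complex.I * x + x ^ 2 / 2‖ ≤ |x| ^ 3 / 6 := by
  rcases le_total 0 x with hx | hx
  · rw [abs_of_nonneg hx]; exact norm_exp_taylor3_nonneg x hx
  · rw [abs_of_nonpos hx]
    have h := norm_exp_taylor3_nonneg (-x) (by linarith)
    rw [← Complex.norm_conj] at h
    simp only [map_add, map_sub, map_mul, map_one, map_div₀, map_pow, ← Complex.exp_conj,
      Complex.conj_I, Complex.conj_ofReal] at h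
    convert h using 2
    push_cast
    simp [Complex.conj_ofNat]

lemma integrable_of_third {Ω : Type*} [MeasurableSpace Ω] (P : Measure Ω)
    [IsProbabilityMeasure P] (Y : Ω → ℝ) (hY : AEMeasurable Y P)
    (h3 : Integrable (fun ω => |Y ω| ^ 3) P) :
    Integrable Y P ∧ Integrable (fun ω => Y ω ^ 2) P := by
  have hi : Integrable (fun ω => 1 + |Y ω| ^ 3) P := (integrable_const 1).add h3
  constructor
  · refine hi.mono' hY.aestronglyMeasurable (Filter.Eventually.of_forall fun ω => ?_)
    rw [Real.norm_eq_abs]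
    nlinarith [abs_nonneg (Y ω), sq_nonneg (|Y ω| - 1), mul_nonneg (abs_nonneg (Y ω)) (sq_nonneg (|Y ω| - 1)), mul_nonneg (abs_nonneg (Y ω)) (sq_nonneg (|Y ω|))]
  · refine hi.mono' (hY.pow_const 2).aestronglyMeasurable (Filter.Eventually.of_forall fun ω => ?_)
    rw [Real.norm_eq_abs, abs_pow]
    nlinarith [abs_nonneg (Y ω), mul_nonneg (abs_nonneg (Y ω)) (sq_nonneg (|Y ω| - 1)), sq_nonneg (|Y ω| - 1)]

lemma charFun_taylor3 {Ω : Type*} [MeasurableSpace Ω] (P : Measure Ω)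
    [IsProbabilityMeasure P] (Y : Ω → ℝ) (hY : AEMeasurable Y P) (β : ℝ)
    (h3 : Integrable (fun ω => |Y ω| ^ 3) P)
    (hm : ∫ ω, Y ω ∂P = 0) (hv : ∫ ω, Y ω ^ 2 ∂P = 1) (hβ : ∫ ω, |Y ω| ^ 3 ∂P = β)
    (u : ℝ) (hu : 0 ≤ u) :
    ‖charFun (P.map Y) u - ((1 - u ^ 2 / 2 : ℝ) : ℂ)‖ ≤ β * u ^ 3 / 6 := by
  obtain ⟨h1, h2⟩ := integrable_of_third P Y hY h3
  rw [charFun_apply_real, integral_map hY (by fun_prop)]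
  have e1 : Integrable (fun ω => Complex.exp (u * Y ω * Complex.I)) P := by
    refine (integrable_const (1 : ℝ)).mono' ?_ (Filter.Eventually.of_forall fun ω => ?_)
    · have : Measurable (fun y : ℝ => Complex.exp (u * y * Complex.I)) := by fun_prop
      exact (this.comp_aemeasurable hY).aestronglyMeasurable
    · have := Complex.norm_exp_ofReal_mul_I (u * Y ω)
      push_cast at this
      exact this.le
  have e2 : Integrable (fun ω => Complex.I * ((u * Y ω : ℝ) : ℂ)) P :=
    ((h1.const_mul u).ofReal).const_mul _
  have e3 : Integrable (fun ω => (((u * Y ω) ^ 2 / 2 : ℝ) : ℂ)) P := by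
    have : Integrable (fun ω => (u * Y ω) ^ 2 / 2) P := by
      have := h2.const_mul (u ^ 2 / 2)
      refine this.congr (Filter.Eventually.of_forall fun ω => ?_)
      simp only; ring
    exact this.ofReal
  have key : ∫ ω, Complex.exp (u * Y ω * Complex.I) ∂P - ((1 - u ^ 2 / 2 : ℝ) : ℂ)
      = ∫ ω, (Complex.exp (u * Y ω * Complex.I) - 1 - Complex.I * ((u * Y ω : ℝ) : ℂ)
        + (((u * Y ω) ^ 2 / 2 : ℝ) : ℂ)) ∂P := by
    have e4 : Integrable (fun ω => Complex.exp (u * Y ω * Complex.I) - 1) P :=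
      e1.sub (integrable_const _)
    have e5 : Integrable (fun ω => Complex.exp (u * Y ω * Complex.I) - 1
      - Complex.I * ((u * Y ω : ℝ) : ℂ)) P := e4.sub e2
    rw [integral_add e5 e3,
      integral_sub e4 e2, integral_sub e1 (integrable_const _),
      integral_const_mul, integral_complex_ofReal, integral_complex_ofReal, integral_const_mul, hm]
    have : ∫ ω, (u * Y ω) ^ 2 / 2 ∂P = u ^ 2 / 2 := by
      have : ∀ ω, (u * Y ω) ^ 2 / 2 = u ^ 2 / 2 * Y ω ^ 2 := fun ω => by ring
      simp_rw [this]
      rw [integral_const_mul, hv, mul_one]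
    rw [this]
    simp
    ring
  rw [key]
  have : β * u ^ 3 / 6 = ∫ ω, u ^ 3 / 6 * |Y ω| ^ 3 ∂P := by
    rw [integral_const_mul, hβ]; ring
  rw [this]
  refine norm_integral_le_of_norm_le (h3.const_mul _) (Filter.Eventually.of_forall fun ω => ?_)
  have h := norm_exp_taylor3 (u * Y ω)
  rw [abs_mul, abs_of_nonneg hu] at h
  have e : Complex.exp (u * Y ω * Complex.I) - 1 - Complex.I * ((u * Y ω : ℝ) : ℂ)
        + (((u * Y ω) ^ 2 / 2 : ℝ) : ℂ) = Complex.exp (Complex.I * ((u * Y ω : ℝ) : ℂ)) - 1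
        - Complex.I * ((u * Y ω : ℝ) : ℂ) + ((u * Y ω : ℝ) : ℂ) ^ 2 / 2 := by
    push_cast
    rw [mul_comm Complex.I]
  rw [e]
  refine h.trans (le_of_eq ?_)
  ring

lemma one_le_third {Ω : Type*} [MeasurableSpace Ω] (P : Measure Ω)
    [IsProbabilityMeasure P] (Y : Ω → ℝ) (hY : AEMeasurable Y P) (β : ℝ)
    (h3 : Integrable (fun ω => |Y ω| ^ 3) P)
    (hv : ∫ ω, Y ω ^ 2 ∂P = 1) (hβ : ∫ ω, |Y ω| ^ 3 ∂P = β) : 1 ≤ β := by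
  obtain ⟨h1, h2⟩ := integrable_of_third P Y hY h3
  have : ∫ ω, (3 / 2 * Y ω ^ 2 - 1 / 2) ∂P ≤ ∫ ω, |Y ω| ^ 3 ∂P := by
    refine integral_mono ((h2.const_mul _).sub (integrable_const _)) h3 fun ω => ?_
    simp only
    rw [← sq_abs]
    nlinarith [abs_nonneg (Y ω), mul_nonneg (abs_nonneg (Y ω)) (sq_nonneg (|Y ω| - 1)), sq_nonneg (|Y ω| - 1)]
  rw [integral_sub (h2.const_mul _) (integrable_const _), integral_const_mul, hv, hβ] at this
  simp at this
  linarith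


lemma norm_pow_sub_pow_le_max (a b : ℂ) (M : ℝ) (ha : ‖a‖ ≤ M) (hb : ‖b‖ ≤ M) (n : ℕ) :
    ‖a ^ n - b ^ n‖ ≤ n * ‖a - b‖ * M ^ (n - 1) := by
  have hM : 0 ≤ M := (norm_nonneg a).trans ha
  rw [← Commute.geom_sum₂_mul (Commute.all a b) n, norm_mul]
  have : ‖∑ i ∈ Finset.range n, a ^ i * b ^ (n - 1 - i)‖ ≤ n * M ^ (n - 1) := by
    refine (norm_sum_le _ _).trans ?_
    have : ∀ i ∈ Finset.range n, ‖a ^ i * b ^ (n - 1 - i)‖ ≤ M ^ (n - 1) := by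
      intro i hi
      have hi' : i ≤ n - 1 := by have := Finset.mem_range.1 hi; omega
      rw [norm_mul, norm_pow, norm_pow]
      calc ‖a‖ ^ i * ‖b‖ ^ (n - 1 - i) ≤ M ^ i * M ^ (n - 1 - i) := by gcongr
        _ = M ^ (n - 1) := by rw [← pow_add]; congr 1; omega
    refine (Finset.sum_le_sum this).trans ?_
    simp
  nlinarith [norm_nonneg (a - b)]

/-- basic bound in the range `L t ≤ √2` -/
lemma char_diff_small (a : ℂ) (n : ℕ) (hn : 0 < n) (β L t u : ℝ) (hβ : 1 ≤ β)
    (hL : L * Real.sqrt n = β) (hu : u * Real.sqrt n = t) (ht : 0 ≤ t)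
    (ha : ‖a - ((1 - u ^ 2 / 2 : ℝ) : ℂ)‖ ≤ β * u ^ 3 / 6) (hLt : (L * t) ^ 2 ≤ 2) :
    ‖a ^ n - ((Real.exp (-t ^ 2 / 2) : ℝ) : ℂ)‖ ≤
      (L * t ^ 3 / 6 + L ^ 2 * t ^ 4 / 8) *
        Real.exp (-((1 - L ^ 2) * (t ^ 2 * (1 / 2 - L * t / 6)))) := by
  have hn' : (0 : ℝ) < n := by exact_mod_cast hn
  have hs : 0 < Real.sqrt n := Real.sqrt_pos.2 hn'
  have hss : Real.sqrt n ^ 2 = n := Real.sq_sqrt hn'.le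
  have hu0 : 0 ≤ u := by
    by_contra h
    push Not at h
    nlinarith
  have hL0 : 0 < L := by
    by_contra h
    push Not at h
    nlinarith
  set s := Real.sqrt n with hsdef
  have hLt' : L * t = β * u := by rw [← hL, ← hu]; ring
  have hLn : 1 ≤ L ^ 2 * n := by rw [← hss, ← mul_pow, hL]; nlinarith
  have hw : β * u ≤ 3 / 2 := by
    rw [← hLt']
    have : 0 ≤ L * t := by positivity
    nlinarith
  have hbu0 : 0 ≤ β * u := by positivity
  have hu2 : u ^ 2 ≤ 2 := by
    have : u ≤ L * t := by rw [hLt']; nlinarith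
    nlinarith
  set M := Real.exp (-(u ^ 2 * (1 / 2 - L * t / 6))) with hM
  set b : ℂ := ((Real.exp (-u ^ 2 / 2) : ℝ) : ℂ) with hb
  have hbn : b ^ n = ((Real.exp (-t ^ 2 / 2) : ℝ) : ℂ) := by
    rw [hb, ← Complex.ofReal_pow, ← Real.exp_nat_mul, ← hu, mul_pow, hss]
    congr 2; ring
  have haM : ‖a‖ ≤ M := by
    have h1 : ‖a‖ ≤ ‖a - ((1 - u ^ 2 / 2 : ℝ) : ℂ)‖ + ‖((1 - u ^ 2 / 2 : ℝ) : ℂ)‖ := by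
      exact norm_le_norm_sub_add _ _
    rw [Complex.norm_real, Real.norm_eq_abs, abs_of_nonneg (by linarith)] at h1
    have h2 := Real.add_one_le_exp (-(u ^ 2 * (1 / 2 - L * t / 6)))
    rw [hLt'] at h2 hM
    rw [hM]
    nlinarith
  have hbM : ‖b‖ ≤ M := by
    rw [hb, Complex.norm_real, Real.norm_eq_abs, abs_of_pos (Real.exp_pos _), hM]
    apply Real.exp_le_exp.2
    have : 0 ≤ u ^ 2 * (L * t) := by positivity
    nlinarith
  have hab : ‖a - b‖ ≤ β * u ^ 3 / 6 + u ^ 4 / 8 := by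
    have h1 : ‖a - b‖ ≤ ‖a - ((1 - u ^ 2 / 2 : ℝ) : ℂ)‖ + ‖((1 - u ^ 2 / 2 : ℝ) : ℂ) - b‖ := by
      exact norm_sub_le_norm_sub_add_norm_sub _ _ _
    have h2 : ‖((1 - u ^ 2 / 2 : ℝ) : ℂ) - b‖ ≤ u ^ 4 / 8 := by
      rw [hb, ← Complex.ofReal_sub, Complex.norm_real, Real.norm_eq_abs, abs_le]
      have e1 := Real.add_one_le_exp (-u ^ 2 / 2)
      have e2 : Real.exp (-u ^ 2 / 2) ≤ 1 - u ^ 2 / 2 + u ^ 4 / 8 := by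
        have h3 := Real.quadratic_le_exp_of_nonneg (x := u ^ 2 / 2) (by positivity)
        have h4 : Real.exp (-u ^ 2 / 2) * Real.exp (u ^ 2 / 2) = 1 := by
          rw [← Real.exp_add]; ring_nf; simp
        have h5 := Real.exp_pos (-u ^ 2 / 2)
        have h6 : 1 ≤ (1 - u ^ 2 / 2 + u ^ 4 / 8) * (1 + u ^ 2 / 2 + (u ^ 2 / 2) ^ 2 / 2) := by
          nlinarith [sq_nonneg (u ^ 4)]
        have h7 : 0 < 1 + u ^ 2 / 2 + (u ^ 2 / 2) ^ 2 / 2 := by positivity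
        have h8 : Real.exp (-u ^ 2 / 2) * (1 + u ^ 2 / 2 + (u ^ 2 / 2) ^ 2 / 2) ≤ 1 := by
          exact (mul_le_mul_of_nonneg_left h3 h5.le).trans h4.le
        exact le_of_mul_le_mul_right (h8.trans h6) h7
      constructor <;> nlinarith
    linarith
  rw [← hbn]
  refine (norm_pow_sub_pow_le_max a b M haM hbM n).trans ?_
  have hMn : M ^ (n - 1) ≤ Real.exp (-((1 - L ^ 2) * (t ^ 2 * (1 / 2 - L * t / 6)))) := by
    rw [hM, ← Real.exp_nat_mul]
    apply Real.exp_le_exp.2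
    rw [Nat.cast_sub hn]
    push_cast
    have e : (1 - L ^ 2) * (t ^ 2 * (1 / 2 - L * t / 6))
        = (n - L ^ 2 * n) * (u ^ 2 * (1 / 2 - L * t / 6)) := by
      have : t ^ 2 = u ^ 2 * n := by rw [← hu, mul_pow, hss]
      rw [this]; ring
    rw [e]
    have : 0 ≤ u ^ 2 * (1 / 2 - L * t / 6) := by
      apply mul_nonneg (sq_nonneg _); rw [hLt']; linarith
    nlinarith
  have hnab : n * ‖a - b‖ ≤ L * t ^ 3 / 6 + L ^ 2 * t ^ 4 / 8 := by
    have e1 : n * (β * u ^ 3 / 6) = L * t ^ 3 / 6 := by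
      rw [← hss, ← hL, ← hu]; ring
    have e2 : n * (u ^ 4 / 8) ≤ L ^ 2 * t ^ 4 / 8 := by
      have : t ^ 4 = u ^ 4 * n * n := by
        rw [← hss, ← hu]; ring
      rw [this]
      have h8 : 0 ≤ u ^ 4 * n / 8 := by positivity
      have h9 := mul_le_mul_of_nonneg_left hLn h8
      calc n * (u ^ 4 / 8) = u ^ 4 * n / 8 * 1 := by ring
        _ ≤ _ := h9
        _ = _ := by ring
    calc n * ‖a - b‖ ≤ n * (β * u ^ 3 / 6 + u ^ 4 / 8) := by gcongr
      _ = n * (β * u ^ 3 / 6) + n * (u ^ 4 / 8) := by ring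
      _ ≤ _ := by linarith
  have h0 : 0 ≤ M ^ (n - 1) := by positivity
  exact mul_le_mul hnab hMn h0 (by positivity)

/-- crude bound in the range `√2 ≤ L t ≤ π/2` -/
lemma char_diff_large (a : ℂ) (n : ℕ) (hn : 0 < n) (β L t u : ℝ) (hβ : 1 ≤ β)
    (hL : L * Real.sqrt n = β) (hu : u * Real.sqrt n = t) (ht : 0 ≤ t)
    (ha : ‖a - ((1 - u ^ 2 / 2 : ℝ) : ℂ)‖ ≤ β * u ^ 3 / 6) (hLt : 2 ≤ (L * t) ^ 2)
    (hLt2 : L * t ≤ 1.571) :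
    ‖a ^ n - ((Real.exp (-t ^ 2 / 2) : ℝ) : ℂ)‖ ≤ 2 * Real.exp (-(0.12 / L ^ 2)) := by
  have hn' : (0 : ℝ) < n := by exact_mod_cast hn
  have hs : 0 < Real.sqrt n := Real.sqrt_pos.2 hn'
  have hss : Real.sqrt n ^ 2 = n := Real.sq_sqrt hn'.le
  have hu0 : 0 ≤ u := by
    by_contra h
    push Not at h
    nlinarith
  have hL0 : 0 < L := by
    by_contra h
    push Not at h
    nlinarith
  set s := Real.sqrt n with hsdef
  have hLt' : L * t = β * u := by rw [← hL, ← hu]; ring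
  have hLn : 1 / L ^ 2 ≤ n := by
    rw [div_le_iff₀ (by positivity), mul_comm, ← hss, ← mul_pow, hL]; nlinarith
  have hbu0 : 0 ≤ β * u := by positivity
  have hul : u ≤ L * t := by rw [hLt']; nlinarith
  have ht2 : 2 * (1 / L ^ 2) ≤ t ^ 2 := by
    rw [mul_one_div, div_le_iff₀ (by positivity), ← mul_pow, mul_comm t]; exact hLt
  have hz : 0 < 1 / L ^ 2 := by positivity
  have h12 : 0.12 / L ^ 2 = 0.12 * (1 / L ^ 2) := by ring
  rw [h12]
  set z := 1 / L ^ 2 with hzdef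
  have h1 : ‖a‖ ≤ ‖a - ((1 - u ^ 2 / 2 : ℝ) : ℂ)‖ + ‖((1 - u ^ 2 / 2 : ℝ) : ℂ)‖ := by
    exact norm_le_norm_sub_add _ _
  have hA : ‖a ^ n‖ ≤ Real.exp (-(0.12 * z)) := by
    rw [norm_pow]
    rcases le_total (u ^ 2) 2 with hu2 | hu2
    · rw [Complex.norm_real, Real.norm_eq_abs, abs_of_nonneg (by linarith)] at h1
      have h2 := Real.add_one_le_exp (-(u ^ 2 * (1 / 2 - L * t / 6)))
      rw [hLt'] at h2
      have haM : ‖a‖ ≤ Real.exp (-(u ^ 2 * (1 / 2 - β * u / 6))) := by nlinarith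
      refine (pow_le_pow_left₀ (norm_nonneg _) haM n).trans ?_
      rw [← Real.exp_nat_mul]
      apply Real.exp_le_exp.2
      have e : (n : ℝ) * -(u ^ 2 * (1 / 2 - β * u / 6)) = -(t ^ 2 * (1 / 2 - L * t / 6)) := by
        have : t ^ 2 = u ^ 2 * n := by rw [← hu, mul_pow, hss]
        rw [this, hLt']; ring
      rw [e]
      nlinarith
    · rw [Complex.norm_real, Real.norm_eq_abs, abs_of_nonpos (by linarith)] at h1
      have h3 : u ^ 2 ≤ 1.571 ^ 2 := by
        have : u ≤ 1.571 := hul.trans hLt2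
        gcongr
      have h4 : β * u ^ 3 ≤ 1.571 * 1.571 ^ 2 := by
        have : β * u ^ 3 = (L * t) * u ^ 2 := by rw [hLt']; ring
        rw [this]; gcongr
      have haM : ‖a‖ ≤ Real.exp (-0.12) := by
        have h5 := Real.add_one_le_exp (-0.12 : ℝ)
        have h6 : ‖a‖ ≤ 0.8803 := by norm_num at h3 h4 ⊢; linarith
        linarith [h6, h5, show (0.8803:ℝ) = 0.88 + 0.0003 by norm_num, show (0.885 : ℝ) ≤ Real.exp (-0.12) by
          have := Real.add_one_le_exp (-0.06 : ℝ)
          have e : Real.exp (-0.12) = Real.exp (-0.06) ^ 2 := by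
            rw [← Real.exp_nat_mul]; norm_num
          have e0 := Real.exp_pos (-0.06 : ℝ)
          have h7 := Real.add_one_le_exp (-0.03 : ℝ)
          have e' : Real.exp (-0.06) = Real.exp (-0.03) ^ 2 := by
            rw [← Real.exp_nat_mul]; norm_num
          have e1 := Real.exp_pos (-0.03 : ℝ)
          have h8 : (0.97 : ℝ) ^ 2 ≤ Real.exp (-0.03) ^ 2 := by
            gcongr; norm_num at h7 ⊢; linarith
          have h9 : ((0.97 : ℝ) ^ 2) ^ 2 ≤ (Real.exp (-0.03) ^ 2) ^ 2 := by gcongr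
          rw [e, e']; norm_num at h9 ⊢; linarith]
      refine (pow_le_pow_left₀ (norm_nonneg _) haM n).trans ?_
      rw [← Real.exp_nat_mul]
      apply Real.exp_le_exp.2
      nlinarith
  have hB : ‖((Real.exp (-t ^ 2 / 2) : ℝ) : ℂ)‖ ≤ Real.exp (-(0.12 * z)) := by
    rw [Complex.norm_real, Real.norm_eq_abs, abs_of_pos (Real.exp_pos _)]
    apply Real.exp_le_exp.2
    nlinarith
  refine (norm_sub_le _ _).trans ?_
  linarith


lemma sum_inv_sq_le (y : ℝ) (hy : ∀ n : ℤ, y ≠ n) (s : Finset ℤ) :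
    Real.sin (Real.pi * y) ^ 2 / Real.pi ^ 2 * ∑ n ∈ s, 1 / (y - n) ^ 2 ≤ 1 := by
  have hab : (0 : ℝ) < 1 := one_pos
  set f : ℝ → ℂ := fun x => Complex.exp (Complex.I * ((2 * Real.pi * y * x : ℝ) : ℂ)) with hf
  have hcont : Continuous f := by rw [hf]; fun_prop
  have hnorm : ∀ x, ‖f x‖ = 1 := fun x => Complex.norm_exp_I_mul_ofReal _
  have hL2 : MemLp f 2 (volume.restrict (Set.Ioc (0 : ℝ) 1)) :=
    MemLp.of_bound hcont.aestronglyMeasurable 1 (Filter.Eventually.of_forall fun x => (hnorm x).le)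
  have h := hasSum_sq_fourierCoeffOn hab hL2
  simp only [hnorm] at h
  norm_num at h
  have hc : ∀ n : ℤ, ‖fourierCoeffOn hab f n‖ ^ 2
      = Real.sin (Real.pi * y) ^ 2 / Real.pi ^ 2 * (1 / (y - n) ^ 2) := by
    intro n
    have hyn : y - n ≠ 0 := sub_ne_zero.2 (hy n)
    rw [fourierCoeffOn_eq_integral]
    have e1 : ∫ x in (0 : ℝ)..1, fourier (-n) (x : AddCircle (1 - 0 : ℝ)) • f x
        = (Complex.exp (Complex.I * ((2 * Real.pi * (y - n) : ℝ) : ℂ)) - 1)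
          / (Complex.I * ((2 * Real.pi * (y - n) : ℝ) : ℂ)) := by
      have hne : Complex.I * ((2 * Real.pi * (y - n) : ℝ) : ℂ) ≠ 0 := by
        refine mul_ne_zero Complex.I_ne_zero (Complex.ofReal_ne_zero.2 ?_)
        have := Real.pi_ne_zero
        positivity
      have := integral_exp_mul_complex (a := 0) (b := 1) hne
      simp only [Complex.ofReal_zero, mul_zero, Complex.exp_zero, Complex.ofReal_one, mul_one] at this
      rw [← this]
      apply intervalIntegral.integral_congr
      intro x _
      simp only [hf, fourier_coe_apply, smul_eq_mul]
      rw [← Complex.exp_add]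
      congr 1
      push_cast
      ring
    rw [e1]
    simp only [sub_zero, one_div, inv_one, one_smul]
    rw [norm_div, Complex.norm_exp_I_mul_ofReal_sub_one, norm_mul Complex.I, Complex.norm_I, Complex.norm_real]
    have e2 : Real.sin (2 * Real.pi * (y - n) / 2) ^ 2 = Real.sin (Real.pi * y) ^ 2 := by
      have : 2 * Real.pi * (y - n) / 2 = Real.pi * y - n * Real.pi := by ring
      rw [this, Real.sin_sub_int_mul_pi, mul_pow]
      rcases Int.even_or_odd n with hh | hh
      · rw [hh.neg_one_zpow]; simp
      · rw [hh.neg_one_zpow]; simp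
    rw [div_pow, one_mul, Real.norm_eq_abs, Real.norm_eq_abs, sq_abs, sq_abs, mul_pow, e2]
    have := Real.pi_ne_zero
    field_simp
  simp only [hc] at h
  rw [Finset.mul_sum]
  exact sum_le_hasSum s (fun i _ => by positivity) h


/-- bracket in the Selberg minorant -/
noncomputable def selG (N : ℕ) (y : ℝ) : ℝ :=
  ∑ n ∈ Finset.Ico 1 N, 1 / (y - n) ^ 2 + 1 / y - 1 / (y - N)

lemma selG_nonpos_of_neg (N : ℕ) (hN : 1 ≤ N) (y : ℝ) (hy : y < 0) : selG N y ≤ 0 := by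
  have key : ∀ M : ℕ, 1 ≤ M →
      ∑ n ∈ Finset.Ico 1 M, 1 / (y - n) ^ 2 + 1 / y - 1 / (y - M + 1) ≤ 0 := by
    intro M hM
    induction M, hM using Nat.le_induction with
    | base => simp
    | succ M hM ih =>
      rw [Finset.sum_Ico_succ_top hM]
      have hM' : (1 : ℝ) ≤ M := by exact_mod_cast hM
      push_cast
      have e1 : 1 / (y - M) ^ 2 + 1 / (y - M + 1) - 1 / (y - M) ≤ 0 := by
        have h1 : 0 < -(y - M) := by linarith
        have h2 : 0 < -(y - M + 1) := by linarith
        have e : 1 / (y - M) ^ 2 + 1 / (y - M + 1) - 1 / (y - M)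
            = -(1 / ((-(y - M)) ^ 2 * -(y - M + 1))) := by
          have h1' : y - M ≠ 0 := by linarith
          have h2' : y - M + 1 ≠ 0 := by linarith
          field_simp
          ring
        rw [e]
        have : 0 < 1 / ((-(y - M)) ^ 2 * -(y - M + 1)) := by positivity
        linarith
      have e2 : y - (M + 1) + 1 = y - M := by ring
      rw [e2]
      linarith
  have h := key N hN
  unfold selG
  have hN' : (1 : ℝ) ≤ N := by exact_mod_cast hN
  have : 1 / (y - N + 1) ≤ 1 / (y - N) := by
    rw [one_div_le_one_div_of_neg (by linarith) (by linarith)]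
    linarith
  linarith

lemma selG_nonpos_of_gt (N : ℕ) (hN : 1 ≤ N) (y : ℝ) (hy : (N : ℝ) < y) : selG N y ≤ 0 := by
  unfold selG
  induction N, hN using Nat.le_induction with
  | base =>
    simp at hy ⊢
    rw [inv_le_inv₀ (by linarith) (by linarith)]
    linarith
  | succ M hM ih =>
    have hM' : (1 : ℝ) ≤ M := by exact_mod_cast hM
    push_cast at hy ⊢
    rw [Finset.sum_Ico_succ_top hM]
    have := ih (by linarith)
    have e1 : 1 / (y - M) ^ 2 + 1 / (y - M) - 1 / (y - (M + 1)) ≤ 0 := by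
      have h1 : 0 < y - M := by linarith
      have h2 : 0 < y - (M + 1) := by linarith
      have e : 1 / (y - M) ^ 2 + 1 / (y - M) - 1 / (y - (M + 1))
          = -(1 / ((y - M) ^ 2 * (y - (M + 1)))) := by
        field_simp
        ring
      rw [e]
      have : 0 < 1 / ((y - M) ^ 2 * (y - (M + 1))) := by positivity
      linarith
    linarith

lemma selG_le_sum (N : ℕ) (y : ℝ) (hy0 : 0 < y) (hyN : y < N) (M : ℕ) :
    selG N y ≤ ∑ n ∈ Finset.Ico (1 - (M : ℤ)) (N + M), 1 / (y - n) ^ 2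
      + 1 / (y + M) + 1 / (N - y + M) := by
  induction M with
  | zero =>
    unfold selG
    have e : ∑ n ∈ Finset.Ico (1 - ((0 : ℕ) : ℤ)) (N + (0 : ℕ)), 1 / (y - n) ^ 2
        = ∑ n ∈ Finset.Ico 1 N, 1 / (y - n) ^ 2 := by
      have : Finset.Ico (1 - ((0 : ℕ) : ℤ)) (N + (0 : ℕ)) = (Finset.Ico 1 N).image (Nat.cast) := by
        ext k
        simp only [Finset.mem_image, Finset.mem_Ico]
        constructor
        · intro h
          exact ⟨k.toNat, by omega, by omega⟩
        · rintro ⟨a, h, rfl⟩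
          omega
      rw [this, Finset.sum_image (by intro a _ b _ h; exact_mod_cast h)]
      simp
    rw [e]
    have : 1 / (y - N) = - (1 / (N - y)) := by
      rw [← neg_sub, one_div, one_div, neg_inv, inv_neg]
    rw [this]
    simp
  | succ M ih =>
    refine ih.trans ?_
    have hM : (0 : ℝ) ≤ M := Nat.cast_nonneg M
    have e : Finset.Ico (1 - ((M + 1 : ℕ) : ℤ)) (N + (M + 1 : ℕ))
        = insert (-(M : ℤ)) (insert ((N : ℤ) + M) (Finset.Ico (1 - (M : ℤ)) (N + M))) := by
      ext k
      simp only [Finset.mem_Ico, Finset.mem_insert]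
      have : (0:ℝ) < N := hy0.trans hyN
      have : 0 < N := by exact_mod_cast this
      push_cast
      omega
    rw [e, Finset.sum_insert, Finset.sum_insert]
    · push_cast
      have step : ∀ z : ℝ, 0 < z → 1 / z ≤ 1 / z ^ 2 + 1 / (z + 1) := by
        intro z hz
        have : 1 / z ^ 2 + 1 / (z + 1) - 1 / z = 1 / (z ^ 2 * (z + 1)) := by
          field_simp
          ring
        have h2 : 0 < 1 / (z ^ 2 * (z + 1)) := by positivity
        linarith
      have h1 := step (y + M) (by linarith)
      have h2 := step (N - y + M) (by linarith)
      have e1 : y - -(M : ℝ) = y + M := by ring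
      have e2 : (y - (N + M)) ^ 2 = (N - y + M) ^ 2 := by ring
      have e3 : (N : ℝ) - y + (M + 1) = N - y + M + 1 := by ring
      have e4 : y + ((M : ℝ) + 1) = y + M + 1 := by ring
      rw [e1, e2, e3, e4]
      linarith
    · simp
    · simp only [Finset.mem_insert, Finset.mem_Ico]
      have : (0:ℝ) < N := hy0.trans hyN
      have : 0 < N := by exact_mod_cast this
      omega

lemma selG_le_one (N : ℕ) (y : ℝ) (hy0 : 0 < y) (hyN : y < N) (hy : ∀ n : ℤ, y ≠ n) :
    Real.sin (Real.pi * y) ^ 2 / Real.pi ^ 2 * selG N y ≤ 1 := by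
  set c := Real.sin (Real.pi * y) ^ 2 / Real.pi ^ 2 with hc
  have hc0 : 0 ≤ c := by positivity
  have h : ∀ M : ℕ, c * selG N y ≤ 1 + c * (1 / (y + M) + 1 / (N - y + M)) := by
    intro M
    have h1 := mul_le_mul_of_nonneg_left (selG_le_sum N y hy0 hyN M) hc0
    have h2 := sum_inv_sq_le y hy (Finset.Ico (1 - (M : ℤ)) (N + M))
    rw [← hc] at h2
    linarith
  have t1 : ∀ a : ℝ, Filter.Tendsto (fun M : ℕ => 1 / (a + M)) Filter.atTop (nhds 0) := by
    intro a
    have : Filter.Tendsto (fun M : ℕ => a + (M : ℝ)) Filter.atTop Filter.atTop :=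
      Filter.tendsto_atTop_add_const_left _ _ tendsto_natCast_atTop_atTop
    simp only [one_div]
    exact this.inv_tendsto_atTop
  have t2 : Filter.Tendsto (fun M : ℕ => 1 + c * (1 / (y + M) + 1 / (N - y + M)))
      Filter.atTop (nhds (1 + c * (0 + 0))) :=
    (((t1 y).add (t1 (N - y))).const_mul c).const_add 1
  have := ge_of_tendsto' t2 h
  simpa using this

noncomputable def selB (N : ℕ) (t x : ℝ) : ℝ :=
  (1 / N) * ((1 - t / (2 * Real.pi * N)) * ∑ n ∈ Finset.Ico 1 N, Real.cos (t * (x - 1 - n / N))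
    + 1 / (2 * Real.pi) * (Real.sin (t * (x - 1)) - Real.sin (t * (x - 2))))

lemma integral_tri_cos (T a : ℝ) (hT : T ≠ 0) (ha : a ≠ 0) :
    ∫ t in (0 : ℝ)..T, (1 - t / T) * Real.cos (t * a) = (1 - Real.cos (T * a)) / (T * a ^ 2) := by
  have hd : ∀ t : ℝ, HasDerivAt (fun t : ℝ => (1 - t / T) * (Real.sin (t * a) / a)
      - Real.cos (t * a) / (T * a ^ 2)) ((1 - t / T) * Real.cos (t * a)) t := by
    intro t
    have h1 : HasDerivAt (fun t : ℝ => t * a) a t := by simpa using (hasDerivAt_id t).mul_const a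
    have h2 : HasDerivAt (fun t : ℝ => 1 - t / T) (-(1 / T)) t := by
      simpa using ((hasDerivAt_id t).div_const T).const_sub 1
    have h3 := (h2.mul (h1.sin.div_const a)).sub (h1.cos.div_const (T * a ^ 2))
    refine h3.congr_deriv ?_
    field_simp
    ring
  rw [intervalIntegral.integral_eq_sub_of_hasDerivAt (fun t _ => hd t)
    (by apply Continuous.intervalIntegrable; fun_prop)]
  simp [hT]
  ring

lemma integral_tri_one (T : ℝ) (hT : T ≠ 0) :
    ∫ t in (0 : ℝ)..T, (1 - t / T) * Real.cos (t * 0) = T / 2 := by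
  simp
  field_simp
  norm_num

lemma integral_sin_mul (T a : ℝ) :
    ∫ t in (0 : ℝ)..T, Real.sin (t * a) = (1 - Real.cos (T * a)) / a := by
  rcases eq_or_ne a 0 with rfl | ha
  · simp
  · rw [intervalIntegral.integral_comp_mul_right _ ha]
    simp
    ring

lemma integral_selB (N : ℕ) (x : ℝ) :
    ∫ t in (0 : ℝ)..(2 * Real.pi * N), selB N t x =
    (1 / N) * (∑ n ∈ Finset.Ico 1 N, (∫ t in (0 : ℝ)..(2 * Real.pi * N),
        (1 - t / (2 * Real.pi * N)) * Real.cos (t * (x - 1 - n / N)))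
    + 1 / (2 * Real.pi) * ((1 - Real.cos ((2 * Real.pi * N) * (x - 1))) / (x - 1)
      - (1 - Real.cos ((2 * Real.pi * N) * (x - 2))) / (x - 2))) := by
  unfold selB
  rw [intervalIntegral.integral_const_mul]
  congr 1
  simp_rw [Finset.mul_sum]
  rw [intervalIntegral.integral_add, intervalIntegral.integral_finsetSum,
    intervalIntegral.integral_const_mul, intervalIntegral.integral_sub,
    integral_sin_mul, integral_sin_mul]
  all_goals first
    | (intro i _; apply Continuous.intervalIntegrable; fun_prop)
    | (apply Continuous.intervalIntegrable; fun_prop)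

lemma selB_minorant (N : ℕ) (hN : 1 ≤ N) (x : ℝ) :
    1 / Real.pi * ∫ t in (0 : ℝ)..(2 * Real.pi * N), selB N t x
      ≤ Set.indicator (Set.Icc (1 : ℝ) 2) (fun _ => (1 : ℝ)) x := by
  have hN' : (0 : ℝ) < N := by exact_mod_cast hN
  have hpi := Real.pi_pos
  have hT : 2 * Real.pi * N ≠ 0 := by positivity
  rw [integral_selB]
  obtain ⟨y, hy⟩ : ∃ y : ℝ, x = 1 + y / N := ⟨N * (x - 1), by field_simp; ring⟩
  have hc1 : Real.cos (2 * Real.pi * N * (x - 1)) = Real.cos (2 * (Real.pi * y)) := by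
    congr 1; rw [hy]; field_simp; ring
  have hcn : ∀ n : ℤ, Real.cos (2 * Real.pi * N * (x - 1 - n / N)) = Real.cos (2 * (Real.pi * y)) := by
    intro n
    rw [← Real.cos_sub_int_mul_two_pi (2 * (Real.pi * y)) n]
    congr 1; rw [hy]; field_simp; ring
  have hc2 : Real.cos (2 * Real.pi * N * (x - 2)) = Real.cos (2 * (Real.pi * y)) := by
    rw [← hcn N]; congr 1; push_cast; rw [div_self hN'.ne']; ring
  rw [hc1, hc2]
  have hmem : x ∈ Set.Icc (1 : ℝ) 2 ↔ 0 ≤ y ∧ y ≤ N := by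
    rw [hy, Set.mem_Icc]
    have h1 : (1 : ℝ) ≤ 1 + y / N ↔ 0 ≤ y := by
      rw [le_add_iff_nonneg_right]
      constructor
      · intro h; by_contra hh; push Not at hh
        have := div_neg_of_neg_of_pos hh hN'; linarith
      · intro h; positivity
    have h2 : 1 + y / N ≤ (2 : ℝ) ↔ y ≤ N := by
      rw [← div_le_one hN']; constructor <;> intro h <;> linarith
    rw [h1, h2]
  by_cases hIntg : ∃ m : ℤ, y = m
  · obtain ⟨m, rfl⟩ := hIntg
    have hcos : Real.cos (2 * (Real.pi * m)) = 1 := by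
      rw [show 2 * (Real.pi * (m : ℝ)) = m * (2 * Real.pi) by ring, Real.cos_int_mul_two_pi]
    rw [hcos]
    have hterm : ∀ n ∈ Finset.Ico 1 N, (∫ t in (0 : ℝ)..(2 * Real.pi * N),
        (1 - t / (2 * Real.pi * N)) * Real.cos (t * (x - 1 - n / N)))
        = if (n : ℤ) = m then Real.pi * N else 0 := by
      intro n _
      split_ifs with h
      · have : x - 1 - n / N = 0 := by rw [hy, ← h]; push_cast; ring
        rw [this, integral_tri_one _ hT]; ring
      · have hne : x - 1 - n / N ≠ 0 := by
          rw [hy]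
          have : (1 + (m : ℝ) / N - 1 - n / N) = ((m : ℝ) - n) / N := by ring
          rw [this]
          apply div_ne_zero _ hN'.ne'
          rw [sub_ne_zero]
          intro h'
          apply h
          exact_mod_cast h'.symm
        rw [integral_tri_cos _ _ hT hne]
        have := hcn n
        push_cast at this
        rw [this, hcos]; simp
    rw [Finset.sum_congr rfl hterm]
    by_cases hm : 1 ≤ m ∧ m < N
    · obtain ⟨k, rfl⟩ := Int.eq_ofNat_of_zero_le (by omega : 0 ≤ m)
      have hx : x ∈ Set.Icc (1 : ℝ) 2 := by
        rw [hmem]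
        constructor
        · push_cast; positivity
        · push_cast; have := hm.2; exact_mod_cast this.le
      rw [Set.indicator_of_mem hx]
      simp only [Nat.cast_inj, Finset.sum_ite_eq', Finset.mem_Ico]
      rw [if_pos (by omega)]
      simp
      field_simp
      norm_num
    · have : ∑ n ∈ Finset.Ico 1 N, (if (n : ℤ) = m then Real.pi * N else 0) = 0 := by
        apply Finset.sum_eq_zero
        intro n hn
        rw [Finset.mem_Ico] at hn
        rw [if_neg]
        intro h
        apply hm
        omega
      rw [this]
      simp
      apply Set.indicator_nonneg
      intro _ _; exact zero_le_one
  · push Not at hIntg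
    have hsin : 1 - Real.cos (2 * (Real.pi * y)) = 2 * Real.sin (Real.pi * y) ^ 2 := by
      rw [Real.cos_two_mul, Real.cos_sq']; ring
    have hval : 1 / Real.pi * ((1 / N) * (∑ n ∈ Finset.Ico 1 N, (∫ t in (0 : ℝ)..(2 * Real.pi * N),
        (1 - t / (2 * Real.pi * N)) * Real.cos (t * (x - 1 - n / N)))
        + 1 / (2 * Real.pi) * ((1 - Real.cos (2 * (Real.pi * y))) / (x - 1)
      - (1 - Real.cos (2 * (Real.pi * y))) / (x - 2))))
        = Real.sin (Real.pi * y) ^ 2 / Real.pi ^ 2 * selG N y := by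
      have hterm : ∀ n ∈ Finset.Ico 1 N, (∫ t in (0 : ℝ)..(2 * Real.pi * N),
        (1 - t / (2 * Real.pi * N)) * Real.cos (t * (x - 1 - n / N)))
        = N * Real.sin (Real.pi * y) ^ 2 / Real.pi * (1 / (y - n) ^ 2) := by
        intro n _
        have hyn : y - n ≠ 0 := by
          have := hIntg n
          push_cast at this
          exact sub_ne_zero.2 this
        have e : x - 1 - n / N = (y - n) / N := by rw [hy]; ring
        rw [integral_tri_cos _ _ hT (by rw [e]; exact div_ne_zero hyn hN'.ne')]
        have := hcn n
        push_cast at this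
        rw [this, hsin, e]
        field_simp
      rw [Finset.sum_congr rfl hterm, ← Finset.mul_sum, hsin]
      unfold selG
      have hy0 : y ≠ 0 := by simpa using hIntg 0
      have hyN : y - N ≠ 0 := by
        have := hIntg N
        push_cast at this
        exact sub_ne_zero.2 this
      have e1 : x - 1 = y / N := by rw [hy]; ring
      have e2 : x - 2 = (y - N) / N := by rw [hy]; field_simp; ring
      rw [e1, e2]
      field_simp
      ring
    rw [hval]
    have hc0 : 0 ≤ Real.sin (Real.pi * y) ^ 2 / Real.pi ^ 2 := by positivity
    by_cases hx : x ∈ Set.Icc (1 : ℝ) 2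
    · rw [Set.indicator_of_mem hx]
      obtain ⟨h1, h2⟩ := hmem.1 hx
      have hy0 : y ≠ 0 := by simpa using hIntg 0
      have hyN : y ≠ N := by simpa using hIntg N
      exact selG_le_one N y (lt_of_le_of_ne h1 hy0.symm) (lt_of_le_of_ne h2 hyN) hIntg
    · rw [Set.indicator_of_notMem hx]
      rw [hmem, not_and_or] at hx
      apply mul_nonpos_of_nonneg_of_nonpos hc0
      rcases hx with hx | hx
      · exact selG_nonpos_of_neg N hN y (not_le.1 hx)
      · exact selG_nonpos_of_gt N hN y (not_le.1 hx)


lemma integral_t3 (a : ℝ) (ha : a ≠ 0) (x y : ℝ) :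
    ∫ t in x..y, t ^ 3 * Real.exp (-(a * t ^ 2))
      = (a * x ^ 2 + 1) / (2 * a ^ 2) * Real.exp (-(a * x ^ 2))
        - (a * y ^ 2 + 1) / (2 * a ^ 2) * Real.exp (-(a * y ^ 2)) := by
  have hd : ∀ t : ℝ, HasDerivAt (fun t : ℝ => -((a * t ^ 2 + 1) / (2 * a ^ 2)
      * Real.exp (-(a * t ^ 2)))) (t ^ 3 * Real.exp (-(a * t ^ 2))) t := by
    intro t
    have h1 : HasDerivAt (fun t : ℝ => a * t ^ 2) (a * (2 * t)) t := by
      simpa using (hasDerivAt_pow 2 t).const_mul a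
    have h3 := ((((h1.add_const 1).div_const (2 * a ^ 2)).mul h1.neg.exp)).neg
    refine h3.congr_deriv ?_
    simp only [Pi.neg_apply]
    field_simp
    ring
  rw [intervalIntegral.integral_eq_sub_of_hasDerivAt (fun t _ => hd t)
    (by apply Continuous.intervalIntegrable; fun_prop)]
  ring

lemma integral_t5 (a : ℝ) (ha : a ≠ 0) (x y : ℝ) :
    ∫ t in x..y, t ^ 5 * Real.exp (-(a * t ^ 2))
      = (a ^ 2 * x ^ 4 + 2 * a * x ^ 2 + 2) / (2 * a ^ 3) * Real.exp (-(a * x ^ 2))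
        - (a ^ 2 * y ^ 4 + 2 * a * y ^ 2 + 2) / (2 * a ^ 3) * Real.exp (-(a * y ^ 2)) := by
  have hd : ∀ t : ℝ, HasDerivAt (fun t : ℝ => -((a ^ 2 * t ^ 4 + 2 * a * t ^ 2 + 2) / (2 * a ^ 3)
      * Real.exp (-(a * t ^ 2)))) (t ^ 5 * Real.exp (-(a * t ^ 2))) t := by
    intro t
    have h1 : HasDerivAt (fun t : ℝ => a * t ^ 2) (a * (2 * t)) t := by
      simpa using (hasDerivAt_pow 2 t).const_mul a
    have h2 : HasDerivAt (fun t : ℝ => a ^ 2 * t ^ 4 + 2 * a * t ^ 2 + 2)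
        (a ^ 2 * (4 * t ^ 3) + 2 * a * (2 * t)) t := by
      simpa using (((hasDerivAt_pow 4 t).const_mul (a ^ 2)).add
        ((hasDerivAt_pow 2 t).const_mul (2 * a))).add_const 2
    have h3 := (((h2.div_const (2 * a ^ 3)).mul h1.neg.exp)).neg
    refine h3.congr_deriv ?_
    simp only [Pi.neg_apply]
    field_simp
    ring
  rw [intervalIntegral.integral_eq_sub_of_hasDerivAt (fun t _ => hd t)
    (by apply Continuous.intervalIntegrable; fun_prop)]
  ring

set_option maxHeartbeats 1000000 in
lemma D_int (D : ℝ → ℝ) (hc : Continuous D) (L : ℝ) (hL : 0 < L) (hL8 : L ≤ 1 / 8)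
    (h0 : ∀ t, 0 ≤ D t)
    (h1 : ∀ t, 0 ≤ t → (L * t) ^ 2 ≤ 2 →
      D t ≤ (L * t ^ 3 / 6 + L ^ 2 * t ^ 4 / 8) *
        Real.exp (-((1 - L ^ 2) * (t ^ 2 * (1 / 2 - L * t / 6)))))
    (h2 : ∀ t, 0 ≤ t → 2 ≤ (L * t) ^ 2 → L * t ≤ 1.571 → D t ≤ 2 * Real.exp (-(0.12 / L ^ 2)))
    (T : ℝ) (hT0 : 0 ≤ T) (hT : L * T ≤ Real.pi / 2)
    (z0 e2 e3 : ℝ) (hz0 : 64 ≤ z0) (hz : z0 * L ^ 2 ≤ 1)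
    (he2 : (1 + 0.065 * z0) * Real.exp (-(0.065 * z0)) ≤ e2)
    (he3 : z0 * Real.exp (-(0.12 * z0)) ≤ e3) :
    ∫ t in (0 : ℝ)..T, D t ≤ L * (0.496 + 0.826 * L + 2.542 * e2 + 0.32 * e3) := by
  have hi : ∀ a b : ℝ, IntervalIntegrable D volume a b := fun a b => hc.intervalIntegrable a b
  have s2 : Real.sqrt 2 ≤ 1.41422 := by
    rw [Real.sqrt_le_left (by norm_num)]; norm_num
  have s2' : (1.414 : ℝ) ≤ Real.sqrt 2 := by
    apply Real.le_sqrt_of_sq_le; norm_num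
  have s22 : Real.sqrt 2 ^ 2 = 2 := Real.sq_sqrt (by norm_num)
  have hTle : T ≤ 1.571 / L := by
    rw [le_div_iff₀ hL]; have := Real.pi_lt_d4; linarith
  have hstep : ∫ t in (0 : ℝ)..T, D t ≤ ∫ t in (0 : ℝ)..(1.571 / L), D t := by
    apply intervalIntegral.integral_mono_interval le_rfl hT0 hTle
      (Filter.Eventually.of_forall fun t => h0 t) (hi _ _)
  have t1pos : 0 < 1 / (2 * L) := by positivity
  have hL2 : L ^ 2 ≤ 1 / 64 := by nlinarith
  -- first range
  have I1 : ∫ t in (0 : ℝ)..(1 / (2 * L)), D t ≤ L * (0.496 + 0.826 * L) := by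
    have hb : ∀ t ∈ Set.Icc (0 : ℝ) (1 / (2 * L)), D t ≤
        (L / 6 + L ^ 2 / 8) * (t ^ 3 * Real.exp (-(0.41 * t ^ 2)))
          + L ^ 2 / 32 * (t ^ 5 * Real.exp (-(0.41 * t ^ 2))) := by
      intro t ht
      have hLt : L * t ≤ 1 / 2 := by
        have := ht.2; rw [le_div_iff₀ (by positivity)] at this; linarith
      have ht0 := ht.1
      have hLt0 : 0 ≤ L * t := by positivity
      refine (h1 t ht0 (by nlinarith)).trans ?_
      have hE : Real.exp (-((1 - L ^ 2) * (t ^ 2 * (1 / 2 - L * t / 6))))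
          ≤ Real.exp (-(0.41 * t ^ 2)) := by
        apply Real.exp_le_exp.2
        have : 0.41 ≤ (1 - L ^ 2) * (1 / 2 - L * t / 6) := by nlinarith
        nlinarith [sq_nonneg t]
      have hP : L * t ^ 3 / 6 + L ^ 2 * t ^ 4 / 8
          ≤ (L / 6 + L ^ 2 / 8) * t ^ 3 + L ^ 2 / 32 * t ^ 5 := by
        have : t ^ 4 ≤ t ^ 3 + t ^ 5 / 4 := by
          have : 0 ≤ t ^ 3 * (1 - t / 2) ^ 2 := by positivity
          nlinarith
        nlinarith [sq_nonneg L]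
      calc _ ≤ (L * t ^ 3 / 6 + L ^ 2 * t ^ 4 / 8) * Real.exp (-(0.41 * t ^ 2)) :=
            mul_le_mul_of_nonneg_left hE (by positivity)
        _ ≤ ((L / 6 + L ^ 2 / 8) * t ^ 3 + L ^ 2 / 32 * t ^ 5) * Real.exp (-(0.41 * t ^ 2)) :=
            mul_le_mul_of_nonneg_right hP (Real.exp_pos _).le
        _ = _ := by ring
    have := intervalIntegral.integral_mono_on (μ := volume) t1pos.le (hi _ _)
      (by apply Continuous.intervalIntegrable; fun_prop) hb
    refine this.trans ?_
    rw [intervalIntegral.integral_add (by apply Continuous.intervalIntegrable; fun_prop)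
      (by apply Continuous.intervalIntegrable; fun_prop), intervalIntegral.integral_const_mul,
      intervalIntegral.integral_const_mul, integral_t3 _ (by norm_num), integral_t5 _ (by norm_num)]
    set s := 1 / (2 * L) with hs
    have p1 : 0 ≤ (0.41 * s ^ 2 + 1) / (2 * 0.41 ^ 2) * Real.exp (-(0.41 * s ^ 2)) := by positivity
    have p2 : 0 ≤ (0.41 ^ 2 * s ^ 4 + 2 * 0.41 * s ^ 2 + 2) / (2 * 0.41 ^ 3)
      * Real.exp (-(0.41 * s ^ 2)) := by positivity
    have q1 := mul_nonneg (by positivity : 0 ≤ L / 6 + L ^ 2 / 8) p1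
    have q2 := mul_nonneg (by positivity : 0 ≤ L ^ 2 / 32) p2
    have z1 : Real.exp (-(0.41 * (0 : ℝ) ^ 2)) = 1 := by simp
    rw [z1, mul_sub, mul_sub]
    have : (L / 6 + L ^ 2 / 8) * ((0.41 * (0 : ℝ) ^ 2 + 1) / (2 * 0.41 ^ 2) * 1)
      + L ^ 2 / 32 * ((0.41 ^ 2 * (0 : ℝ) ^ 4 + 2 * 0.41 * 0 ^ 2 + 2) / (2 * 0.41 ^ 3) * 1)
        ≤ L * (0.496 + 0.826 * L) := by
      norm_num
      nlinarith [sq_nonneg L]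
    linarith
  have hzL : z0 ≤ 1 / L ^ 2 := by rw [le_div_iff₀ (by positivity)]; exact hz
  have t12 : 1 / (2 * L) ≤ Real.sqrt 2 / L := by
    rw [div_le_div_iff₀ (by positivity) hL]; nlinarith
  have t23 : Real.sqrt 2 / L ≤ 1.571 / L := by
    apply div_le_div_of_nonneg_right _ hL.le; linarith
  have I2 : ∫ t in (1 / (2 * L))..(Real.sqrt 2 / L), D t ≤ L * (2.542 * e2) := by
    have hb : ∀ t ∈ Set.Icc (1 / (2 * L)) (Real.sqrt 2 / L), D t ≤
        (0.34345 * L) * (t ^ 3 * Real.exp (-(0.26 * t ^ 2))) := by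
      intro t ht
      have ht0 : 0 ≤ t := t1pos.le.trans ht.1
      have hLt : L * t ≤ Real.sqrt 2 := by
        have := ht.2; rw [le_div_iff₀ (by positivity)] at this; linarith
      have hLt0 : 0 ≤ L * t := by positivity
      refine (h1 t ht0 (by nlinarith)).trans ?_
      have hE : Real.exp (-((1 - L ^ 2) * (t ^ 2 * (1 / 2 - L * t / 6))))
          ≤ Real.exp (-(0.26 * t ^ 2)) := by
        apply Real.exp_le_exp.2
        have : 0.26 ≤ (1 - L ^ 2) * (1 / 2 - L * t / 6) := by nlinarith
        nlinarith [sq_nonneg t]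
      have hP : L * t ^ 3 / 6 + L ^ 2 * t ^ 4 / 8 ≤ 0.34345 * L * t ^ 3 := by
        have e : L * t ^ 3 / 6 + L ^ 2 * t ^ 4 / 8 = (1 / 6 + L * t / 8) * (L * t ^ 3) := by ring
        rw [e, mul_assoc]
        apply mul_le_mul_of_nonneg_right _ (by positivity)
        linarith
      calc _ ≤ (L * t ^ 3 / 6 + L ^ 2 * t ^ 4 / 8) * Real.exp (-(0.26 * t ^ 2)) :=
            mul_le_mul_of_nonneg_left hE (by positivity)
        _ ≤ (0.34345 * L * t ^ 3) * Real.exp (-(0.26 * t ^ 2)) :=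
            mul_le_mul_of_nonneg_right hP (Real.exp_pos _).le
        _ = _ := by ring
    have := intervalIntegral.integral_mono_on (μ := volume) t12 (hi _ _)
      (by apply Continuous.intervalIntegrable; fun_prop) hb
    refine this.trans ?_
    rw [intervalIntegral.integral_const_mul, integral_t3 _ (by norm_num)]
    set s := Real.sqrt 2 / L with hs
    have p1 : 0 ≤ (0.26 * s ^ 2 + 1) / (2 * 0.26 ^ 2) * Real.exp (-(0.26 * s ^ 2)) := by positivity
    have e : 0.26 * (1 / (2 * L)) ^ 2 = 0.065 * (1 / L ^ 2) := by field_simp; norm_num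
    rw [e]
    set z := 1 / L ^ 2 with hzdef
    have key : (0.065 * z + 1) * Real.exp (-(0.065 * z)) ≤ e2 := by
      refine le_trans ?_ he2
      have e5 : Real.exp (-(0.065 * z0)) = Real.exp (0.065 * (z - z0)) * Real.exp (-(0.065 * z)) := by
        rw [← Real.exp_add]; congr 1; ring
      rw [e5, ← mul_assoc]
      apply mul_le_mul_of_nonneg_right _ (Real.exp_pos _).le
      have h7 := Real.add_one_le_exp (0.065 * (z - z0))
      have h8 := mul_le_mul_of_nonneg_left h7 (by linarith : 0 ≤ 1 + 0.065 * z0)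
      have h9 : 0 ≤ z0 * (z - z0) := mul_nonneg (by linarith) (by linarith)
      linarith
    have e6 : (0.065 * z + 1) / (2 * 0.26 ^ 2) * Real.exp (-(0.065 * z))
      = ((0.065 * z + 1) * Real.exp (-(0.065 * z))) / (2 * 0.26 ^ 2) := by ring
    rw [e6]
    have e2pos : 0 ≤ e2 := le_trans (by positivity) he2
    have : (0.065 * z + 1) * Real.exp (-(0.065 * z)) / (2 * 0.26 ^ 2)  ≤ e2 * 7.3965 := by
      rw [div_le_iff₀ (by norm_num)]; nlinarith
    calc _ ≤ 0.34345 * L * (e2 * 7.3965) := by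
            apply mul_le_mul_of_nonneg_left _ (by positivity); linarith
      _ ≤ _ := by
        have := mul_nonneg hL.le e2pos
        nlinarith
  have I3 : ∫ t in (Real.sqrt 2 / L)..(1.571 / L), D t ≤ L * (0.32 * e3) := by
    have hb : ∀ t ∈ Set.Icc (Real.sqrt 2 / L) (1.571 / L), D t ≤ 2 * Real.exp (-(0.12 / L ^ 2)) := by
      intro t ht
      have ht0 : 0 ≤ t := (t1pos.le.trans t12).trans ht.1
      have hLt : Real.sqrt 2 ≤ L * t := by
        have := ht.1; rw [div_le_iff₀ (by positivity)] at this; linarith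
      have hLt2 : L * t ≤ 1.571 := by
        have := ht.2; rw [le_div_iff₀ (by positivity)] at this; linarith
      exact h2 t ht0 (by nlinarith) hLt2
    have := intervalIntegral.integral_mono_on (μ := volume) t23 (hi _ _)
      (by apply Continuous.intervalIntegrable; fun_prop) hb
    refine this.trans ?_
    rw [intervalIntegral.integral_const, smul_eq_mul]
    have e : 0.12 / L ^ 2 = 0.12 * (1 / L ^ 2) := by ring
    have e' : (1.571 / L - Real.sqrt 2 / L) = L * ((1.571 - Real.sqrt 2) * (1 / L ^ 2)) := by
      field_simp
    rw [e, e']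
    set z := 1 / L ^ 2 with hzdef
    have zpos : 0 < z := by positivity
    have key : z * Real.exp (-(0.12 * z)) ≤ e3 := by
      refine le_trans ?_ he3
      have e5 : Real.exp (-(0.12 * z0)) = Real.exp (0.12 * (z - z0)) * Real.exp (-(0.12 * z)) := by
        rw [← Real.exp_add]; congr 1; ring
      rw [e5, ← mul_assoc]
      apply mul_le_mul_of_nonneg_right _ (Real.exp_pos _).le
      have h7 := Real.add_one_le_exp (0.12 * (z - z0))
      have h8 := mul_le_mul_of_nonneg_left h7 (by linarith : 0 ≤ z0)
      have h9 : 0 ≤ (z0 - 64) * (z - z0) := mul_nonneg (by linarith) (by linarith)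
      linarith
    calc _ = L * ((1.571 - Real.sqrt 2) * 2 * (z * Real.exp (-(0.12 * z)))) := by ring
      _ ≤ L * (0.32 * (z * Real.exp (-(0.12 * z)))) := by
        apply mul_le_mul_of_nonneg_left _ hL.le
        apply mul_le_mul_of_nonneg_right _ (by positivity)
        linarith
      _ ≤ _ := by
        apply mul_le_mul_of_nonneg_left _ hL.le
        linarith
  have a1 := intervalIntegral.integral_add_adjacent_intervals (hi 0 (1 / (2 * L)))
    (hi (1 / (2 * L)) (Real.sqrt 2 / L))
  have a2 := intervalIntegral.integral_add_adjacent_intervals (hi 0 (Real.sqrt 2 / L))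
    (hi (Real.sqrt 2 / L) (1.571 / L))
  linarith

lemma exp_neg_one_le : Real.exp (-1) ≤ 0.36788 := by
  have := Real.exp_neg_one_lt_d9; linarith

lemma exp_neg_nat_le (k : ℕ) : Real.exp (-(k : ℝ)) ≤ 0.36788 ^ k := by
  have : Real.exp (-(k : ℝ)) = Real.exp (-1) ^ k := by
    rw [← Real.exp_nat_mul]; congr 1; ring
  rw [this]
  exact pow_le_pow_left₀ (Real.exp_pos _).le exp_neg_one_le k

lemma exp_neg_quad_le (x : ℝ) (hx : 0 ≤ x) : Real.exp (-x) ≤ 1 / (1 + x + x ^ 2 / 2) := by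
  rw [Real.exp_neg, ← one_div]
  apply one_div_le_one_div_of_le (by positivity)
  exact Real.quadratic_le_exp_of_nonneg hx

lemma D_int_cases (D : ℝ → ℝ) (hc : Continuous D) (L : ℝ) (hL : 0 < L) (hL8 : L ≤ 1 / 8)
    (h0 : ∀ t, 0 ≤ D t)
    (h1 : ∀ t, 0 ≤ t → (L * t) ^ 2 ≤ 2 →
      D t ≤ (L * t ^ 3 / 6 + L ^ 2 * t ^ 4 / 8) *
        Real.exp (-((1 - L ^ 2) * (t ^ 2 * (1 / 2 - L * t / 6)))))
    (h2 : ∀ t, 0 ≤ t → 2 ≤ (L * t) ^ 2 → L * t ≤ 1.571 → D t ≤ 2 * Real.exp (-(0.12 / L ^ 2)))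
    (T : ℝ) (hT0 : 0 ≤ T) (hT : L * T ≤ Real.pi / 2) :
    (∫ t in (0 : ℝ)..T, D t ≤ Real.pi * (0.28 * L)) ∧
    (L ≤ 0.1 → ∫ t in (0 : ℝ)..T, D t ≤ Real.pi * (0.2 * L)) ∧
    (L ≤ 1 / 12 → ∫ t in (0 : ℝ)..T, D t ≤ Real.pi * (0.19 * L)) := by
  have hpi := Real.pi_gt_d2
  refine ⟨?_, ?_, ?_⟩
  · have a1 : Real.exp (-(0.065 * 64)) ≤ 0.01563 := by
      have e : Real.exp (-(0.065 * 64)) = Real.exp (-((4 : ℕ) : ℝ)) * Real.exp (-0.16) := by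
        rw [← Real.exp_add]; norm_num
      have b1 := exp_neg_nat_le 4
      have b2 := exp_neg_quad_le 0.16 (by norm_num)
      rw [e]
      refine (mul_le_mul b1 b2 (Real.exp_pos _).le (by norm_num)).trans (by norm_num)
    have a2 : Real.exp (-(0.12 * 64)) ≤ 0.001 := by
      have b1 := exp_neg_nat_le 7
      have : Real.exp (-(0.12 * 64)) ≤ Real.exp (-((7 : ℕ) : ℝ)) :=
        Real.exp_le_exp.2 (by norm_num)
      refine (this.trans b1).trans (by norm_num)
    have := D_int D hc L hL hL8 h0 h1 h2 T hT0 hT 64 0.0807 0.064 le_rfl (by nlinarith)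
      (by linarith) (by linarith)
    refine this.trans ?_
    nlinarith
  · intro hL1
    have a1 : Real.exp (-(0.065 * 100)) ≤ 0.00153 := by
      have e : Real.exp (-(0.065 * 100)) = Real.exp (-((6 : ℕ) : ℝ)) * Real.exp (-0.5) := by
        rw [← Real.exp_add]; norm_num
      have b1 := exp_neg_nat_le 6
      have b2 := exp_neg_quad_le 0.5 (by norm_num)
      rw [e]
      refine (mul_le_mul b1 b2 (Real.exp_pos _).le (by norm_num)).trans (by norm_num)
    have a2 : Real.exp (-(0.12 * 100)) ≤ 0.00001 := by
      have b1 := exp_neg_nat_le 12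
      have : Real.exp (-(0.12 * 100)) ≤ Real.exp (-((12 : ℕ) : ℝ)) :=
        Real.exp_le_exp.2 (by norm_num)
      refine (this.trans b1).trans (by norm_num)
    have := D_int D hc L hL hL8 h0 h1 h2 T hT0 hT 100 0.0115 0.001 (by norm_num) (by nlinarith)
      (by linarith) (by linarith)
    refine this.trans ?_
    nlinarith
  · intro hL1
    have a1 : Real.exp (-(0.065 * 144)) ≤ 0.00013 := by
      have b1 := exp_neg_nat_le 9
      have : Real.exp (-(0.065 * 144)) ≤ Real.exp (-((9 : ℕ) : ℝ)) :=
        Real.exp_le_exp.2 (by norm_num)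
      refine (this.trans b1).trans (by norm_num)
    have a2 : Real.exp (-(0.12 * 144)) ≤ 0.00001 := by
      have b1 := exp_neg_nat_le 12
      have : Real.exp (-(0.12 * 144)) ≤ Real.exp (-((12 : ℕ) : ℝ)) :=
        Real.exp_le_exp.2 (by norm_num)
      refine (this.trans b1).trans (by norm_num)
    have := D_int D hc L hL hL8 h0 h1 h2 T hT0 hT 144 0.0015 0.00144 (by norm_num) (by nlinarith)
      (by linarith) (by linarith)
    refine this.trans ?_
    nlinarith


noncomputable def cT (T x : ℝ) : ℝ := ∫ t in (0 : ℝ)..T, Real.cos (t * x) * Real.exp (-t ^ 2 / 2)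
noncomputable def sT (T x : ℝ) : ℝ := ∫ t in (0 : ℝ)..T, Real.sin (t * x) * Real.exp (-t ^ 2 / 2)
noncomputable def kT (T x : ℝ) : ℝ := ∫ t in (0 : ℝ)..T, t * Real.cos (t * x) * Real.exp (-t ^ 2 / 2)
noncomputable def mT (T x : ℝ) : ℝ := ∫ t in (0 : ℝ)..T, t * Real.sin (t * x) * Real.exp (-t ^ 2 / 2)
noncomputable def dawI (x : ℝ) : ℝ := ∫ s in (0 : ℝ)..x, Real.exp (s ^ 2 / 2)

lemma hasDerivAt_gauss (t : ℝ) :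
    HasDerivAt (fun t : ℝ => Real.exp (-t ^ 2 / 2)) (-t * Real.exp (-t ^ 2 / 2)) t := by
  have h : HasDerivAt (fun t : ℝ => -t ^ 2 / 2) (-t) t := by
    have := ((hasDerivAt_pow 2 t).neg).div_const 2
    refine this.congr_deriv ?_
    push_cast; ring
  refine h.exp.congr_deriv ?_
  ring

lemma hasDerivAt_gaussp (t : ℝ) :
    HasDerivAt (fun t : ℝ => Real.exp (t ^ 2 / 2)) (t * Real.exp (t ^ 2 / 2)) t := by
  have h : HasDerivAt (fun t : ℝ => t ^ 2 / 2) t t := by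
    have := (hasDerivAt_pow 2 t).div_const 2
    refine this.congr_deriv ?_
    push_cast; ring
  refine h.exp.congr_deriv ?_
  ring

lemma kT_eq (T x : ℝ) : kT T x = 1 - Real.exp (-T ^ 2 / 2) * Real.cos (T * x) - x * sT T x := by
  unfold kT sT
  have hd : ∀ t : ℝ, HasDerivAt (fun t : ℝ => -(Real.cos (t * x) * Real.exp (-t ^ 2 / 2)))
      (t * Real.cos (t * x) * Real.exp (-t ^ 2 / 2)
        + x * (Real.sin (t * x) * Real.exp (-t ^ 2 / 2))) t := by
    intro t
    have h1 : HasDerivAt (fun t : ℝ => t * x) x t := by simpa using (hasDerivAt_id t).mul_const x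
    refine ((h1.cos.mul (hasDerivAt_gauss t)).neg).congr_deriv ?_
    ring
  have := intervalIntegral.integral_eq_sub_of_hasDerivAt (a := 0) (b := T) (fun t _ => hd t)
    (by apply Continuous.intervalIntegrable; fun_prop)
  rw [intervalIntegral.integral_add (by apply Continuous.intervalIntegrable; fun_prop)
    (by apply Continuous.intervalIntegrable; fun_prop), intervalIntegral.integral_const_mul] at this
  simp only [zero_mul, Real.cos_zero, ne_eq, OfNat.ofNat_ne_zero, not_false_eq_true, zero_pow,
    neg_zero, zero_div, Real.exp_zero] at this
  linarith

lemma mT_eq (T x : ℝ) : mT T x = x * cT T x - Real.exp (-T ^ 2 / 2) * Real.sin (T * x) := by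
  unfold mT cT
  have hd : ∀ t : ℝ, HasDerivAt (fun t : ℝ => -(Real.sin (t * x) * Real.exp (-t ^ 2 / 2)))
      (t * Real.sin (t * x) * Real.exp (-t ^ 2 / 2)
        - x * (Real.cos (t * x) * Real.exp (-t ^ 2 / 2))) t := by
    intro t
    have h1 : HasDerivAt (fun t : ℝ => t * x) x t := by simpa using (hasDerivAt_id t).mul_const x
    refine ((h1.sin.mul (hasDerivAt_gauss t)).neg).congr_deriv ?_
    ring
  have := intervalIntegral.integral_eq_sub_of_hasDerivAt (a := 0) (b := T) (fun t _ => hd t)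
    (by apply Continuous.intervalIntegrable; fun_prop)
  rw [intervalIntegral.integral_sub (by apply Continuous.intervalIntegrable; fun_prop)
    (by apply Continuous.intervalIntegrable; fun_prop), intervalIntegral.integral_const_mul] at this
  simp only [zero_mul, Real.sin_zero, neg_zero] at this
  linarith

lemma gauss_le_one (t : ℝ) : Real.exp (-t ^ 2 / 2) ≤ 1 := by
  apply Real.exp_le_one_iff.2; nlinarith [sq_nonneg t]

lemma hasDerivAt_sT (T x : ℝ) : HasDerivAt (fun x => sT T x) (kT T x) x := by
  unfold sT kT
  refine (intervalIntegral.hasDerivAt_integral_of_dominated_loc_of_deriv_le (μ := volume)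
    (F := fun x t => Real.sin (t * x) * Real.exp (-t ^ 2 / 2))
    (F' := fun x t => t * Real.cos (t * x) * Real.exp (-t ^ 2 / 2)) (x₀ := x) (s := Set.univ)
    (bound := fun t => |t|) Filter.univ_mem ?_ ?_ ?_ ?_ ?_ ?_).2
  · exact Filter.Eventually.of_forall fun y => by
      apply Continuous.aestronglyMeasurable; fun_prop
  · apply Continuous.intervalIntegrable; fun_prop
  · apply Continuous.aestronglyMeasurable; fun_prop
  · refine Filter.Eventually.of_forall fun t _ y _ => ?_
    rw [norm_mul, norm_mul, Real.norm_eq_abs, Real.norm_eq_abs, Real.norm_eq_abs, Real.abs_exp]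
    have h1 := Real.abs_cos_le_one (t * y)
    have h2 := gauss_le_one t
    have h3 := abs_nonneg t
    have h4 : |t| * |Real.cos (t * y)| ≤ |t| := mul_le_of_le_one_right h3 h1
    exact (mul_le_of_le_one_right (by positivity) h2).trans h4
  · apply Continuous.intervalIntegrable; fun_prop
  · refine Filter.Eventually.of_forall fun t _ y _ => ?_
    have h1 : HasDerivAt (fun y : ℝ => t * y) t y := by simpa using (hasDerivAt_id y).const_mul t
    refine (h1.sin.mul_const _).congr_deriv ?_
    ring

lemma hasDerivAt_cT (T x : ℝ) : HasDerivAt (fun x => cT T x) (-mT T x) x := by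
  unfold cT mT
  rw [← intervalIntegral.integral_neg]
  refine (intervalIntegral.hasDerivAt_integral_of_dominated_loc_of_deriv_le (μ := volume)
    (F := fun x t => Real.cos (t * x) * Real.exp (-t ^ 2 / 2))
    (F' := fun x t => -(t * Real.sin (t * x) * Real.exp (-t ^ 2 / 2))) (x₀ := x) (s := Set.univ)
    (bound := fun t => |t|) Filter.univ_mem ?_ ?_ ?_ ?_ ?_ ?_).2
  · exact Filter.Eventually.of_forall fun y => by
      apply Continuous.aestronglyMeasurable; fun_prop
  · apply Continuous.intervalIntegrable; fun_prop
  · apply Continuous.aestronglyMeasurable; fun_prop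
  · refine Filter.Eventually.of_forall fun t _ y _ => ?_
    rw [norm_neg, norm_mul, norm_mul, Real.norm_eq_abs, Real.norm_eq_abs, Real.norm_eq_abs,
      Real.abs_exp]
    have h1 := Real.abs_sin_le_one (t * y)
    have h2 := gauss_le_one t
    have h3 := abs_nonneg t
    have h4 : |t| * |Real.sin (t * y)| ≤ |t| := mul_le_of_le_one_right h3 h1
    exact (mul_le_of_le_one_right (by positivity) h2).trans h4
  · apply Continuous.intervalIntegrable; fun_prop
  · refine Filter.Eventually.of_forall fun t _ y _ => ?_
    have h1 : HasDerivAt (fun y : ℝ => t * y) t y := by simpa using (hasDerivAt_id y).const_mul t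
    refine (h1.cos.mul_const _).congr_deriv ?_
    ring

lemma sT_bounds (T x : ℝ) (hx : 0 ≤ x) :
    (1 - Real.exp (-T ^ 2 / 2)) * dawI x ≤ Real.exp (x ^ 2 / 2) * sT T x ∧
    Real.exp (x ^ 2 / 2) * sT T x ≤ (1 + Real.exp (-T ^ 2 / 2)) * dawI x := by
  set δ := Real.exp (-T ^ 2 / 2) with hδ
  have hδ0 : 0 < δ := Real.exp_pos _
  have hd : ∀ y : ℝ, HasDerivAt (fun y : ℝ => Real.exp (y ^ 2 / 2) * sT T y)
      (Real.exp (y ^ 2 / 2) * (1 - δ * Real.cos (T * y))) y := by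
    intro y
    refine ((hasDerivAt_gaussp y).mul (hasDerivAt_sT T y)).congr_deriv ?_
    rw [kT_eq]; ring
  have h := intervalIntegral.integral_eq_sub_of_hasDerivAt (a := 0) (b := x) (fun t _ => hd t)
    (by apply Continuous.intervalIntegrable; fun_prop)
  have s0 : sT T 0 = 0 := by simp [sT]
  rw [s0, mul_zero, sub_zero] at h
  rw [← h, dawI, ← intervalIntegral.integral_const_mul, ← intervalIntegral.integral_const_mul]
  constructor
  · apply intervalIntegral.integral_mono_on hx
      (by apply Continuous.intervalIntegrable; fun_prop)
      (by apply Continuous.intervalIntegrable; fun_prop)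
    intro y _
    rw [mul_comm]
    apply mul_le_mul_of_nonneg_left _ (Real.exp_pos _).le
    nlinarith [Real.cos_le_one (T * y)]
  · apply intervalIntegral.integral_mono_on hx
      (by apply Continuous.intervalIntegrable; fun_prop)
      (by apply Continuous.intervalIntegrable; fun_prop)
    intro y _
    rw [mul_comm _ (Real.exp (y ^ 2 / 2))]
    apply mul_le_mul_of_nonneg_left _ (Real.exp_pos _).le
    nlinarith [Real.neg_one_le_cos (T * y)]

lemma cT_lower (T x : ℝ) (hx : 0 ≤ x) :
    cT T 0 - Real.exp (-T ^ 2 / 2) * dawI x ≤ Real.exp (x ^ 2 / 2) * cT T x := by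
  set δ := Real.exp (-T ^ 2 / 2) with hδ
  have hδ0 : 0 < δ := Real.exp_pos _
  have hd : ∀ y : ℝ, HasDerivAt (fun y : ℝ => Real.exp (y ^ 2 / 2) * cT T y)
      (Real.exp (y ^ 2 / 2) * (δ * Real.sin (T * y))) y := by
    intro y
    refine ((hasDerivAt_gaussp y).mul (hasDerivAt_cT T y)).congr_deriv ?_
    rw [mT_eq]; ring
  have h := intervalIntegral.integral_eq_sub_of_hasDerivAt (a := 0) (b := x) (fun t _ => hd t)
    (by apply Continuous.intervalIntegrable; fun_prop)
  have e0 : Real.exp ((0 : ℝ) ^ 2 / 2) = 1 := by simp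
  rw [e0, one_mul] at h
  have : -δ * dawI x ≤ ∫ y in (0 : ℝ)..x, Real.exp (y ^ 2 / 2) * (δ * Real.sin (T * y)) := by
    rw [dawI, ← intervalIntegral.integral_const_mul]
    apply intervalIntegral.integral_mono_on hx
      (by apply Continuous.intervalIntegrable; fun_prop)
      (by apply Continuous.intervalIntegrable; fun_prop)
    intro y _
    rw [mul_comm]
    apply mul_le_mul_of_nonneg_left _ (Real.exp_pos _).le
    nlinarith [Real.neg_one_le_sin (T * y)]
  linarith

lemma cT_zero (T : ℝ) (hT : 1 ≤ T) :
    Real.sqrt (2 * Real.pi) / 2 - Real.exp (-T ^ 2 / 2) ≤ cT T 0 := by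
  have e : cT T 0 = ∫ t in (0 : ℝ)..T, Real.exp (-t ^ 2 / 2) := by simp [cT]
  rw [e]
  have hg := integral_gaussian_Ioi (1 / 2)
  have e2 : ∀ t : ℝ, -(1 / 2) * t ^ 2 = -t ^ 2 / 2 := fun t => by ring
  simp only [e2] at hg
  have hIntg : Integrable (fun t : ℝ => Real.exp (-t ^ 2 / 2)) := by
    have := integrable_exp_neg_mul_sq (b := 1 / 2) (by norm_num)
    simpa only [e2] using this
  have hIntg2 : Integrable (fun t : ℝ => t * Real.exp (-t ^ 2 / 2)) := by
    have := integrable_mul_exp_neg_mul_sq (b := 1 / 2) (by norm_num)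
    simpa only [e2] using this
  have htend : Filter.Tendsto (fun t : ℝ => -Real.exp (-t ^ 2 / 2)) Filter.atTop (nhds (-0)) := by
    apply Filter.Tendsto.neg
    apply Real.tendsto_exp_atBot.comp
    have h1 : Filter.Tendsto (fun t : ℝ => t ^ 2 / 2) Filter.atTop Filter.atTop :=
      (Filter.tendsto_pow_atTop (by norm_num)).atTop_div_const (by norm_num)
    have := Filter.tendsto_neg_atTop_atBot.comp h1
    refine this.congr fun t => ?_
    simp only [Function.comp]; ring
  have htail : ∫ t in Set.Ioi T, t * Real.exp (-t ^ 2 / 2) = Real.exp (-T ^ 2 / 2) := by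
    have := integral_Ioi_of_hasDerivAt_of_tendsto' (a := T)
      (f := fun t : ℝ => -Real.exp (-t ^ 2 / 2))
      (f' := fun t : ℝ => t * Real.exp (-t ^ 2 / 2)) (m := -0)
      (fun t _ => ((hasDerivAt_gauss t).neg).congr_deriv (by ring)) hIntg2.integrableOn htend
    rw [this]; ring
  have htl : ∫ t in Set.Ioi T, Real.exp (-t ^ 2 / 2) ≤ Real.exp (-T ^ 2 / 2) := by
    rw [← htail]
    apply setIntegral_mono_on hIntg.integrableOn hIntg2.integrableOn measurableSet_Ioi
    intro t ht
    have : 1 ≤ t := hT.trans (le_of_lt ht)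
    nlinarith [Real.exp_pos (-t ^ 2 / 2)]
  have hsplit := intervalIntegral.integral_interval_add_Ioi (a := 0) (b := T)
    hIntg.integrableOn hIntg.integrableOn
  have : Real.sqrt (Real.pi / (1 / 2)) = Real.sqrt (2 * Real.pi) := by congr 1; ring
  rw [this] at hg
  linarith


lemma dawI_nonneg (x : ℝ) (hx : 0 ≤ x) : 0 ≤ dawI x :=
  intervalIntegral.integral_nonneg hx fun _ _ => (Real.exp_pos _).le

lemma dawI_le (x : ℝ) (hx : 0 ≤ x) : dawI x ≤ x * Real.exp (x ^ 2 / 2) := by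
  have : dawI x ≤ ∫ s in (0 : ℝ)..x, Real.exp (x ^ 2 / 2) := by
    apply intervalIntegral.integral_mono_on hx
      (by apply Continuous.intervalIntegrable; fun_prop)
      (by apply Continuous.intervalIntegrable; fun_prop)
    intro s hs
    apply Real.exp_le_exp.2
    have := hs.1
    have := hs.2
    nlinarith
  simpa using this

lemma dawI_lower (x : ℝ) (hx : 0 < x) :
    Real.exp (x ^ 2 / 2) * (1 - Real.exp (-x ^ 2)) ≤ x * dawI x := by
  have h1 : ∫ s in (0 : ℝ)..x, Real.exp (x * s - x ^ 2 / 2) ≤ dawI x := by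
    apply intervalIntegral.integral_mono_on hx.le
      (by apply Continuous.intervalIntegrable; fun_prop)
      (by apply Continuous.intervalIntegrable; fun_prop)
    intro s hs
    apply Real.exp_le_exp.2
    nlinarith [sq_nonneg (x - s)]
  have hd : ∀ s : ℝ, HasDerivAt (fun s : ℝ => Real.exp (x * s - x ^ 2 / 2) / x)
      (Real.exp (x * s - x ^ 2 / 2)) s := by
    intro s
    have h : HasDerivAt (fun s : ℝ => x * s - x ^ 2 / 2) x s := by
      simpa using ((hasDerivAt_id s).const_mul x).sub_const (x ^ 2 / 2)
    refine (h.exp.div_const x).congr_deriv ?_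
    field_simp
  rw [intervalIntegral.integral_eq_sub_of_hasDerivAt (fun t _ => hd t)
    (by apply Continuous.intervalIntegrable; fun_prop)] at h1
  have e1 : x * x - x ^ 2 / 2 = x ^ 2 / 2 := by ring
  have e2 : Real.exp (x * 0 - x ^ 2 / 2) = Real.exp (x ^ 2 / 2) * Real.exp (-x ^ 2) := by
    rw [← Real.exp_add]; congr 1; ring
  rw [e1, e2, div_sub_div_same, div_le_iff₀ hx] at h1
  linarith

lemma dawI_one_le : dawI 1 ≤ 1.1957 := by
  have : dawI 1 ≤ ∫ s in (0 : ℝ)..1, (1 + s ^ 2 / 2 + s ^ 4 / 8 + s ^ 6 / 36) := by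
    apply intervalIntegral.integral_mono_on zero_le_one
      (by apply Continuous.intervalIntegrable; fun_prop)
      (by apply Continuous.intervalIntegrable; fun_prop)
    intro s hs
    have h0 := hs.1
    have h1 := hs.2
    have := Real.exp_bound' (x := s ^ 2 / 2) (by positivity) (by nlinarith) (n := 3) (by norm_num)
    refine this.trans (le_of_eq ?_)
    simp [Finset.sum_range_succ, Nat.factorial]
    ring
  refine this.trans ?_
  have hd : ∀ s : ℝ, HasDerivAt (fun s : ℝ => s + s ^ 3 / 6 + s ^ 5 / 40 + s ^ 7 / 252)
      (1 + s ^ 2 / 2 + s ^ 4 / 8 + s ^ 6 / 36) s := by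
    intro s
    refine (((((hasDerivAt_id s).add ((hasDerivAt_pow 3 s).div_const 6)).add
      ((hasDerivAt_pow 5 s).div_const 40)).add ((hasDerivAt_pow 7 s).div_const 252))).congr_deriv ?_
    push_cast; ring
  rw [intervalIntegral.integral_eq_sub_of_hasDerivAt (fun t _ => hd t)
    (by apply Continuous.intervalIntegrable; fun_prop)]
  norm_num

lemma dawI_two_ge : 4.7245 ≤ dawI 2 := by
  have : ∫ s in (0 : ℝ)..2, (1 + s ^ 2 / 2 + s ^ 4 / 8 + s ^ 6 / 48 + s ^ 8 / 384
      + s ^ 10 / 3840 + s ^ 12 / 46080) ≤ dawI 2 := by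
    apply intervalIntegral.integral_mono_on zero_le_two
      (by apply Continuous.intervalIntegrable; fun_prop)
      (by apply Continuous.intervalIntegrable; fun_prop)
    intro s hs
    have := Real.sum_le_exp_of_nonneg (x := s ^ 2 / 2) (by positivity) 7
    refine le_trans (le_of_eq ?_) this
    simp [Finset.sum_range_succ, Nat.factorial]
    ring
  refine le_trans ?_ this
  have hd : ∀ s : ℝ, HasDerivAt (fun s : ℝ => s + s ^ 3 / 6 + s ^ 5 / 40 + s ^ 7 / 336
      + s ^ 9 / 3456 + s ^ 11 / 42240 + s ^ 13 / 599040)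
      (1 + s ^ 2 / 2 + s ^ 4 / 8 + s ^ 6 / 48 + s ^ 8 / 384
      + s ^ 10 / 3840 + s ^ 12 / 46080) s := by
    intro s
    refine ((((((((hasDerivAt_id s).add ((hasDerivAt_pow 3 s).div_const 6)).add
      ((hasDerivAt_pow 5 s).div_const 40)).add ((hasDerivAt_pow 7 s).div_const 336)).add
      ((hasDerivAt_pow 9 s).div_const 3456)).add ((hasDerivAt_pow 11 s).div_const 42240)).add
      ((hasDerivAt_pow 13 s).div_const 599040))).congr_deriv ?_
    push_cast; ring
  rw [intervalIntegral.integral_eq_sub_of_hasDerivAt (fun t _ => hd t)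
    (by apply Continuous.intervalIntegrable; fun_prop)]
  norm_num

lemma exp_half_le : Real.exp (-(1 : ℝ) ^ 2 / 2) ≤ 0.60655 := by
  have h : Real.exp (-(1 : ℝ) ^ 2 / 2) ^ 2 = Real.exp (-1) := by
    rw [← Real.exp_nat_mul]; congr 1; norm_num
  have := exp_neg_one_le
  apply le_of_sq_le_sq _ (by norm_num)
  rw [h]; norm_num; linarith

lemma exp_two_bounds : 0.1353 ≤ Real.exp (-(2 : ℝ) ^ 2 / 2) ∧ Real.exp (-(2 : ℝ) ^ 2 / 2) ≤ 0.13535 := by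
  have h : Real.exp (-(2 : ℝ) ^ 2 / 2) = Real.exp (-1) ^ 2 := by
    rw [← Real.exp_nat_mul]; congr 1; norm_num
  have h1 := exp_neg_one_le
  have h2 := Real.exp_neg_one_gt_d9
  rw [h]
  constructor <;> nlinarith

lemma sT_diff (T : ℝ) (hδ : Real.exp (-T ^ 2 / 2) ≤ 0.00001) : -0.087 ≤ sT T 2 - sT T 1 := by
  set δ := Real.exp (-T ^ 2 / 2) with hδd
  have hδ0 : 0 < δ := Real.exp_pos _
  have h2 := (sT_bounds T 2 (by norm_num)).1
  have h1 := (sT_bounds T 1 (by norm_num)).2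
  rw [← hδd] at h1 h2
  have d1 := dawI_one_le
  have d2 := dawI_two_ge
  have e1 := exp_half_le
  have e2 := exp_two_bounds.1
  have p1 : Real.exp (-(1 : ℝ) ^ 2 / 2) * Real.exp ((1 : ℝ) ^ 2 / 2) = 1 := by
    rw [← Real.exp_add]; norm_num
  have p2 : Real.exp (-(2 : ℝ) ^ 2 / 2) * Real.exp ((2 : ℝ) ^ 2 / 2) = 1 := by
    rw [← Real.exp_add]; norm_num
  have a1 : sT T 1 ≤ 0.60655 * (1.00001 * 1.1957) := by
    calc sT T 1 = Real.exp (-(1 : ℝ) ^ 2 / 2) * (Real.exp ((1 : ℝ) ^ 2 / 2) * sT T 1) := by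
          rw [← mul_assoc, p1, one_mul]
      _ ≤ Real.exp (-(1 : ℝ) ^ 2 / 2) * ((1 + δ) * dawI 1) :=
          mul_le_mul_of_nonneg_left h1 (Real.exp_pos _).le
      _ ≤ _ := by
          have := dawI_nonneg 1 zero_le_one
          gcongr
          linarith
  have a2 : 0.1353 * (0.99999 * 4.7245) ≤ sT T 2 := by
    calc sT T 2 = Real.exp (-(2 : ℝ) ^ 2 / 2) * (Real.exp ((2 : ℝ) ^ 2 / 2) * sT T 2) := by
          rw [← mul_assoc, p2, one_mul]
      _ ≥ Real.exp (-(2 : ℝ) ^ 2 / 2) * ((1 - δ) * dawI 2) :=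
          mul_le_mul_of_nonneg_left h2 (Real.exp_pos _).le
      _ ≥ _ := by
          have : (0.99999 : ℝ) ≤ 1 - δ := by linarith
          have : (0.99999 : ℝ) * 4.7245 ≤ (1 - δ) * dawI 2 := by gcongr
          gcongr
  norm_num at a1 a2 ⊢
  linarith

lemma cT_ge (T x : ℝ) (hT : 1 ≤ T) (hx : 0 ≤ x) (hx2 : x ≤ 2) :
    Real.sqrt (2 * Real.pi) / 2 * Real.exp (-x ^ 2 / 2) - 3 * Real.exp (-T ^ 2 / 2) ≤ cT T x := by
  set δ := Real.exp (-T ^ 2 / 2) with hδd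
  have hδ0 : 0 < δ := Real.exp_pos _
  have h := cT_lower T x hx
  have h0 := cT_zero T hT
  rw [← hδd] at h h0
  have p1 : Real.exp (-x ^ 2 / 2) * Real.exp (x ^ 2 / 2) = 1 := by
    rw [← Real.exp_add]
    have : -x ^ 2 / 2 + x ^ 2 / 2 = 0 := by ring
    rw [this, Real.exp_zero]
  have hg := gauss_le_one x
  have hg0 : 0 < Real.exp (-x ^ 2 / 2) := Real.exp_pos _
  have hd := dawI_le x hx
  have hd2 : Real.exp (-x ^ 2 / 2) * dawI x ≤ 2 := by
    calc _ ≤ Real.exp (-x ^ 2 / 2) * (x * Real.exp (x ^ 2 / 2)) :=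
          mul_le_mul_of_nonneg_left hd hg0.le
      _ = x * (Real.exp (-x ^ 2 / 2) * Real.exp (x ^ 2 / 2)) := by ring
      _ ≤ 2 := by rw [p1]; linarith
  calc cT T x = Real.exp (-x ^ 2 / 2) * (Real.exp (x ^ 2 / 2) * cT T x) := by
        rw [← mul_assoc, p1, one_mul]
    _ ≥ Real.exp (-x ^ 2 / 2) * (Real.sqrt (2 * Real.pi) / 2 - δ - δ * dawI x) :=
        mul_le_mul_of_nonneg_left (by linarith) hg0.le
    _ = Real.sqrt (2 * Real.pi) / 2 * Real.exp (-x ^ 2 / 2) - δ * Real.exp (-x ^ 2 / 2)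
        - δ * (Real.exp (-x ^ 2 / 2) * dawI x) := by ring
    _ ≥ _ := by nlinarith

lemma kT_le (T x : ℝ) (hx : 0 < x) :
    kT T x ≤ Real.exp (-x ^ 2) + 2 * Real.exp (-T ^ 2 / 2) := by
  rw [kT_eq]
  have h := (sT_bounds T x hx.le).1
  set δ := Real.exp (-T ^ 2 / 2) with hδd
  have hδ0 : 0 < δ := Real.exp_pos _
  have hδ1 : δ ≤ 1 := gauss_le_one T
  have hl := dawI_lower x hx
  have hE : 0 < Real.exp (x ^ 2 / 2) := Real.exp_pos _
  have h1 : (1 - δ) * (1 - Real.exp (-x ^ 2)) ≤ x * sT T x := by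
    have : Real.exp (x ^ 2 / 2) * ((1 - δ) * (1 - Real.exp (-x ^ 2)))
        ≤ Real.exp (x ^ 2 / 2) * (x * sT T x) := by
      nlinarith [mul_le_mul_of_nonneg_left hl (by linarith : 0 ≤ 1 - δ),
        mul_le_mul_of_nonneg_left h hx.le]
    exact le_of_mul_le_mul_left this hE
  have hc := Real.neg_one_le_cos (T * x)
  have he : 0 < Real.exp (-x ^ 2) := Real.exp_pos _
  nlinarith

lemma convex_gauss : ConvexOn ℝ (Set.Icc (1 : ℝ) 2) (fun x : ℝ => Real.exp (-x ^ 2 / 2)) := by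
  apply MonotoneOn.convexOn_of_deriv (convex_Icc _ _)
  · fun_prop
  · intro x _; exact (hasDerivAt_gauss x).differentiableAt.differentiableWithinAt
  · have : ∀ x, deriv (fun x : ℝ => Real.exp (-x ^ 2 / 2)) x = -x * Real.exp (-x ^ 2 / 2) :=
      fun x => (hasDerivAt_gauss x).deriv
    rw [interior_Icc]
    have hd : ∀ x : ℝ, HasDerivAt (fun x : ℝ => -x * Real.exp (-x ^ 2 / 2))
        ((x ^ 2 - 1) * Real.exp (-x ^ 2 / 2)) x := by
      intro x
      refine ((hasDerivAt_neg x).mul (hasDerivAt_gauss x)).congr_deriv ?_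
      ring
    have hm : MonotoneOn (fun x : ℝ => -x * Real.exp (-x ^ 2 / 2)) (Set.Ioo 1 2) := by
      apply monotoneOn_of_deriv_nonneg (convex_Ioo _ _)
      · fun_prop
      · intro x _; exact (hd x).differentiableAt.differentiableWithinAt
      · intro x hx
        rw [interior_Ioo] at hx
        rw [(hd x).deriv]
        have := hx.1
        have : 0 ≤ x ^ 2 - 1 := by nlinarith
        positivity
    intro x hx y hy hxy
    rw [this, this]
    exact hm hx hy hxy

lemma trap_panel (a b : ℝ) (hab : a < b) (ha : 1 ≤ a) (hb : b ≤ 2) :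
    ∫ x in a..b, Real.exp (-x ^ 2 / 2)
      ≤ (b - a) * ((Real.exp (-a ^ 2 / 2) + Real.exp (-b ^ 2 / 2)) / 2) := by
  set A := Real.exp (-a ^ 2 / 2) with hA
  set B := Real.exp (-b ^ 2 / 2) with hB
  have hba : 0 < b - a := by linarith
  have h : ∀ x ∈ Set.Icc a b, Real.exp (-x ^ 2 / 2) ≤ A + (B - A) / (b - a) * (x - a) := by
    intro x hx
    have h1 := hx.1
    have h2 := hx.2
    have := convex_gauss.2 (show a ∈ Set.Icc (1 : ℝ) 2 from ⟨ha, by linarith⟩)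
      (show b ∈ Set.Icc (1 : ℝ) 2 from ⟨by linarith, hb⟩)
      (show 0 ≤ (b - x) / (b - a) by apply div_nonneg <;> linarith)
      (show 0 ≤ (x - a) / (b - a) by apply div_nonneg <;> linarith) (by field_simp; ring)
    simp only [smul_eq_mul] at this
    have e : (b - x) / (b - a) * a + (x - a) / (b - a) * b = x := by field_simp; ring
    rw [e] at this
    refine this.trans (le_of_eq ?_)
    rw [← hA, ← hB]
    field_simp
    ring
  have := intervalIntegral.integral_mono_on (μ := volume) hab.le
    (by apply Continuous.intervalIntegrable; fun_prop)
    (by apply Continuous.intervalIntegrable; fun_prop) h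
  refine this.trans (le_of_eq ?_)
  have hd : ∀ x : ℝ, HasDerivAt (fun x : ℝ => A * x + (B - A) / (b - a) * ((x - a) ^ 2 / 2))
      (A + (B - A) / (b - a) * (x - a)) x := by
    intro x
    have h1 : HasDerivAt (fun x : ℝ => (x - a) ^ 2) (2 * (x - a)) x := by
      have := ((hasDerivAt_id x).sub_const a).pow 2
      refine this.congr_deriv ?_
      simp
    refine (((hasDerivAt_id x).const_mul A).add
      ((h1.div_const 2).const_mul ((B - A) / (b - a)))).congr_deriv ?_
    ring
  rw [intervalIntegral.integral_eq_sub_of_hasDerivAt (fun t _ => hd t)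
    (by apply Continuous.intervalIntegrable; fun_prop)]
  field_simp
  ring

lemma trap_alg (f : ℕ → ℝ) (N : ℕ) (hN : 1 ≤ N) :
    ∑ k ∈ Finset.range N, (f k + f (k + 1)) / 2 = ∑ n ∈ Finset.Ico 1 N, f n + (f 0 + f N) / 2 := by
  induction N, hN using Nat.le_induction with
  | base => simp
  | succ M hM ih =>
    rw [Finset.sum_range_succ, Finset.sum_Ico_succ_top hM, ih]
    ring

lemma trap_sum (N : ℕ) (hN : 1 ≤ N) :
    ∫ x in (1 : ℝ)..2, Real.exp (-x ^ 2 / 2) ≤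
      (1 / N) * (∑ n ∈ Finset.Ico 1 N, Real.exp (-(1 + (n : ℝ) / N) ^ 2 / 2)
        + (Real.exp (-(1 : ℝ) ^ 2 / 2) + Real.exp (-(2 : ℝ) ^ 2 / 2)) / 2) := by
  have hN' : (0 : ℝ) < N := by exact_mod_cast hN
  set f : ℕ → ℝ := fun n => Real.exp (-(1 + (n : ℝ) / N) ^ 2 / 2) with hf
  have h := intervalIntegral.sum_integral_adjacent_intervals (μ := volume)
    (f := fun x : ℝ => Real.exp (-x ^ 2 / 2)) (a := fun k : ℕ => 1 + (k : ℝ) / N) (n := N)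
    (fun k _ => by apply Continuous.intervalIntegrable; fun_prop)
  have e1 : (1 : ℝ) + ((0 : ℕ) : ℝ) / N = 1 := by simp
  have e2 : (1 : ℝ) + (N : ℝ) / N = 2 := by rw [div_self hN'.ne']; norm_num
  simp only [e1, e2] at h
  rw [← h]
  have hp : ∀ k ∈ Finset.range N, ∫ x in (1 + (k : ℝ) / N)..(1 + ((k + 1 : ℕ) : ℝ) / N),
      Real.exp (-x ^ 2 / 2) ≤ (1 / N) * ((f k + f (k + 1)) / 2) := by
    intro k hk
    have hk' : k + 1 ≤ N := Finset.mem_range.1 hk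
    have hk'' : ((k + 1 : ℕ) : ℝ) ≤ N := by exact_mod_cast hk'
    have := trap_panel (1 + (k : ℝ) / N) (1 + ((k + 1 : ℕ) : ℝ) / N)
      (by push_cast; gcongr; linarith) (by
        have : 0 ≤ (k : ℝ) / N := by positivity
        linarith) (by
        have : ((k + 1 : ℕ) : ℝ) / N ≤ 1 := by rw [div_le_one hN']; exact hk''
        linarith)
    refine this.trans (le_of_eq ?_)
    simp only [hf]
    congr 1
    push_cast
    ring
  refine (Finset.sum_le_sum hp).trans (le_of_eq ?_)
  rw [← Finset.mul_sum]
  congr 1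
  have f0 : f 0 = Real.exp (-(1 : ℝ) ^ 2 / 2) := by simp [hf]
  have fN : f N = Real.exp (-(2 : ℝ) ^ 2 / 2) := by simp only [hf, e2]
  rw [← f0, ← fN]
  exact trap_alg f N hN


lemma sqrt_two_pi_bounds : 2.5066 ≤ Real.sqrt (2 * Real.pi) ∧ Real.sqrt (2 * Real.pi) ≤ 2.5067 := by
  have h1 := Real.pi_gt_d6
  have h2 := Real.pi_lt_d6
  constructor
  · apply Real.le_sqrt_of_sq_le; norm_num at *; linarith
  · rw [Real.sqrt_le_left (by norm_num)]; norm_num at *; linarith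

lemma exp_cubic_le (y : ℝ) (hy : |y| ≤ 1) : 1 + y + y ^ 2 / 2 + y ^ 3 / 6 ≤ Real.exp y := by
  have h := Real.exp_bound hy (n := 5) (by norm_num)
  simp [Finset.sum_range_succ, Nat.factorial] at h
  have h2 := (abs_le.1 h).1
  have h3 : |y| ^ 5 ≤ y ^ 4 := by
    have : |y| ^ 5 = |y| * |y| ^ 4 := by ring
    rw [this, Even.pow_abs (by decide)]
    apply mul_le_of_le_one_left (by positivity) hy
  have : 0 ≤ y ^ 4 := by positivity
  norm_num at h2
  linarith

lemma exp_98 : 0.3246 ≤ Real.exp (-9 / 8) := by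
  have h1 := Real.exp_one_lt_d9
  have h2 := Real.exp_bound' (x := 1 / 8) (by norm_num) (by norm_num) (n := 3) (by norm_num)
  simp [Finset.sum_range_succ, Nat.factorial] at h2
  norm_num at h2
  have e : Real.exp (-9 / 8) = (Real.exp 1 * Real.exp (1 / 8))⁻¹ := by
    rw [← Real.exp_add, ← Real.exp_neg]; norm_num
  rw [e]
  rw [le_inv_comm₀ (by norm_num) (by positivity)]
  calc Real.exp 1 * Real.exp (1 / 8) ≤ 2.7182818286 * (2611 / 2304) := by gcongr
    _ ≤ _ := by norm_num

lemma integral_gauss_12 : 0.3388 ≤ ∫ x in (1 : ℝ)..2, Real.exp (-x ^ 2 / 2) := by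
  have hE := exp_98
  have hb : ∀ x ∈ Set.Icc (1 : ℝ) 2, 0.3246 * (1 + (9 / 4 - x ^ 2) / 2 + ((9 / 4 - x ^ 2) / 2) ^ 2 / 2
      + ((9 / 4 - x ^ 2) / 2) ^ 3 / 6) ≤ Real.exp (-x ^ 2 / 2) := by
    intro x hx
    have h1 := hx.1
    have h2 := hx.2
    have h := exp_cubic_le ((9 / 4 - x ^ 2) / 2) (by rw [abs_le]; constructor <;> nlinarith)
    have e : Real.exp (-x ^ 2 / 2) = Real.exp (-9 / 8) * Real.exp ((9 / 4 - x ^ 2) / 2) := by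
      rw [← Real.exp_add]; congr 1; ring
    rw [e]
    calc _ ≤ 0.3246 * Real.exp ((9 / 4 - x ^ 2) / 2) := by gcongr
      _ ≤ _ := by gcongr
  have := intervalIntegral.integral_mono_on (μ := volume) (by norm_num)
    (by apply Continuous.intervalIntegrable; fun_prop)
    (by apply Continuous.intervalIntegrable; fun_prop) hb
  refine le_trans ?_ this
  -- expanded polynomial
  have hpoly : ∀ x : ℝ, 0.3246 * (1 + (9 / 4 - x ^ 2) / 2 + ((9 / 4 - x ^ 2) / 2) ^ 2 / 2
      + ((9 / 4 - x ^ 2) / 2) ^ 3 / 6) = 0.3246 * ((1 + 9 / 8 + (9 / 8) ^ 2 / 2 + (9 / 8) ^ 3 / 6)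
        - (1 + 9 / 8 + (9 / 8) ^ 2 / 2) * (x ^ 2 / 2) + (1 + 9 / 8) * (x ^ 4 / 8) - x ^ 6 / 48) := by
    intro x; ring
  simp only [hpoly]
  have hd : ∀ x : ℝ, HasDerivAt (fun x : ℝ => 0.3246 * ((1 + 9 / 8 + (9 / 8) ^ 2 / 2 + (9 / 8) ^ 3 / 6) * x
        - (1 + 9 / 8 + (9 / 8) ^ 2 / 2) * (x ^ 3 / 6) + (1 + 9 / 8) * (x ^ 5 / 40) - x ^ 7 / 336))
      (0.3246 * ((1 + 9 / 8 + (9 / 8) ^ 2 / 2 + (9 / 8) ^ 3 / 6)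
        - (1 + 9 / 8 + (9 / 8) ^ 2 / 2) * (x ^ 2 / 2) + (1 + 9 / 8) * (x ^ 4 / 8) - x ^ 6 / 48)) x := by
    intro x
    refine ((((((hasDerivAt_id x).const_mul (1 + 9 / 8 + (9 / 8) ^ 2 / 2 + (9 / 8) ^ 3 / 6 : ℝ)).sub
      (((hasDerivAt_pow 3 x).div_const 6).const_mul (1 + 9 / 8 + (9 / 8) ^ 2 / 2 : ℝ))).add
      (((hasDerivAt_pow 5 x).div_const 40).const_mul (1 + 9 / 8 : ℝ))).sub
      ((hasDerivAt_pow 7 x).div_const 336)).const_mul (0.3246 : ℝ)).congr_deriv ?_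
    push_cast; ring
  rw [intervalIntegral.integral_eq_sub_of_hasDerivAt (fun t _ => hd t)
    (by apply Continuous.intervalIntegrable; fun_prop)]
  norm_num

noncomputable def VV (N : ℕ) : ℝ :=
  1 / Real.pi * ∫ t in (0 : ℝ)..(2 * Real.pi * N), Real.exp (-t ^ 2 / 2) * selB N t 0

lemma VV_eq (N : ℕ) : VV N = 1 / (Real.pi * N) * (∑ n ∈ Finset.Ico 1 N,
      (cT (2 * Real.pi * N) (1 + n / N) - kT (2 * Real.pi * N) (1 + n / N) / (2 * Real.pi * N))
      + 1 / (2 * Real.pi) * (sT (2 * Real.pi * N) 2 - sT (2 * Real.pi * N) 1)) := by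
  set T := 2 * Real.pi * N with hT
  have e : ∀ t : ℝ, Real.exp (-t ^ 2 / 2) * selB N t 0 = (1 / N) * (∑ n ∈ Finset.Ico 1 N,
      (Real.cos (t * (1 + n / N)) * Real.exp (-t ^ 2 / 2)
        - 1 / T * (t * Real.cos (t * (1 + n / N)) * Real.exp (-t ^ 2 / 2)))
      + 1 / (2 * Real.pi) * (Real.sin (t * 2) * Real.exp (-t ^ 2 / 2)
        - Real.sin (t * 1) * Real.exp (-t ^ 2 / 2))) := by
    intro t
    unfold selB
    rw [← hT]
    have c : ∀ n : ℕ, Real.cos (t * (0 - 1 - n / N)) = Real.cos (t * (1 + n / N)) := by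
      intro n; rw [← Real.cos_neg]; congr 1; ring
    have s1 : Real.sin (t * (0 - 1)) = - Real.sin (t * 1) := by
      rw [← Real.sin_neg]; congr 1; ring
    have s2 : Real.sin (t * (0 - 2)) = - Real.sin (t * 2) := by
      rw [← Real.sin_neg]; congr 1; ring
    simp only [c]
    rw [s1, s2]
    have : ∑ n ∈ Finset.Ico 1 N, (Real.cos (t * (1 + n / N)) * Real.exp (-t ^ 2 / 2)
        - 1 / T * (t * Real.cos (t * (1 + n / N)) * Real.exp (-t ^ 2 / 2)))
        = Real.exp (-t ^ 2 / 2) * (1 - t / T) * ∑ n ∈ Finset.Ico 1 N, Real.cos (t * (1 + n / N)) := by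
      rw [Finset.mul_sum]
      apply Finset.sum_congr rfl
      intro n _
      ring
    rw [this]
    ring
  unfold VV
  rw [← hT]
  simp only [e]
  rw [intervalIntegral.integral_const_mul, intervalIntegral.integral_add,
    intervalIntegral.integral_finsetSum, intervalIntegral.integral_const_mul,
    intervalIntegral.integral_sub]
  · have : ∀ n ∈ Finset.Ico 1 N, ∫ t in (0 : ℝ)..T, (Real.cos (t * (1 + n / N)) * Real.exp (-t ^ 2 / 2)
        - 1 / T * (t * Real.cos (t * (1 + n / N)) * Real.exp (-t ^ 2 / 2)))
        = cT T (1 + n / N) - kT T (1 + n / N) / T := by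
      intro n _
      rw [intervalIntegral.integral_sub, intervalIntegral.integral_const_mul, cT, kT]
      · ring
      all_goals (apply Continuous.intervalIntegrable; fun_prop)
    rw [Finset.sum_congr rfl this]
    simp only [sT]
    rw [← mul_assoc, one_div_mul_one_div]
  all_goals first
    | (intro i _; apply Continuous.intervalIntegrable; fun_prop)
    | (apply Continuous.intervalIntegrable; fun_prop)

lemma delta_le (N : ℕ) (hN : 2 ≤ N) : Real.exp (-(2 * Real.pi * N) ^ 2 / 2) ≤ 0.00001 / N := by
  have hN' : (2 : ℝ) ≤ N := by exact_mod_cast hN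
  have h1 : Real.exp (-(2 * Real.pi * N) ^ 2 / 2) ≤ Real.exp (-((12 : ℕ) : ℝ)) * Real.exp (-N) := by
    rw [← Real.exp_add]
    apply Real.exp_le_exp.2
    have := Real.pi_gt_three
    have h9 : 9 ≤ Real.pi ^ 2 := by nlinarith
    have : 18 * (N : ℝ) ^ 2 ≤ (2 * Real.pi * N) ^ 2 / 2 := by
      have : (2 * Real.pi * N) ^ 2 / 2 = 2 * (Real.pi ^ 2 * (N : ℝ) ^ 2) := by ring
      rw [this]
      nlinarith [mul_le_mul_of_nonneg_right h9 (sq_nonneg (N : ℝ))]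
    push_cast
    nlinarith
  have h2 := exp_neg_nat_le 12
  have h3 : Real.exp (-(N : ℝ)) ≤ 1 / N := by
    rw [Real.exp_neg, ← one_div]
    apply one_div_le_one_div_of_le (by linarith)
    linarith [Real.add_one_le_exp (N : ℝ)]
  calc _ ≤ _ := h1
    _ ≤ 0.00001 * (1 / N) := by
      apply mul_le_mul (h2.trans (by norm_num)) h3 (Real.exp_pos _).le (by norm_num)
    _ = _ := by ring

lemma VV_lower (N : ℕ) (hN : 2 ≤ N) (q : ℝ)
    (hq : ∑ n ∈ Finset.Ico 1 N, Real.exp (-(1 + (n : ℝ) / N) ^ 2) ≤ N * q) :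
    1 / N * ((∑ n ∈ Finset.Ico 1 N, Real.exp (-(1 + (n : ℝ) / N) ^ 2 / 2)) / Real.sqrt (2 * Real.pi)
      - (0.0001 + (q + 0.087) / (2 * Real.pi)) / Real.pi) ≤ VV N := by
  have hN' : (2 : ℝ) ≤ N := by exact_mod_cast hN
  have hpi := Real.pi_gt_three
  rw [VV_eq]
  set T := 2 * Real.pi * N with hT
  have hT1 : 1 ≤ T := by rw [hT]; nlinarith
  have hδ := delta_le N hN
  rw [← hT] at hδ
  set δ := Real.exp (-T ^ 2 / 2) with hδd
  have hδ0 : 0 < δ := Real.exp_pos _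
  have hδN : δ * N ≤ 0.00001 := by rwa [le_div_iff₀ (by linarith)] at hδ
  have hδ' : δ ≤ 0.00001 := by nlinarith
  have hs := sT_diff T hδ'
  have hsum : ∑ n ∈ Finset.Ico 1 N,
      (Real.sqrt (2 * Real.pi) / 2 * Real.exp (-(1 + (n : ℝ) / N) ^ 2 / 2) - 3 * δ
        - (Real.exp (-(1 + (n : ℝ) / N) ^ 2) + 2 * δ) / T) ≤
      ∑ n ∈ Finset.Ico 1 N, (cT T (1 + n / N) - kT T (1 + n / N) / T) := by
    apply Finset.sum_le_sum
    intro n hn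
    rw [Finset.mem_Ico] at hn
    have hnN : (n : ℝ) ≤ N := by exact_mod_cast hn.2.le
    have h1 : 0 ≤ (n : ℝ) / N := by positivity
    have h2 : (n : ℝ) / N ≤ 1 := by rw [div_le_one (by linarith)]; exact hnN
    have hc := cT_ge T (1 + n / N) hT1 (by linarith) (by linarith)
    have hk := kT_le T (1 + n / N) (by linarith)
    have := div_le_div_of_nonneg_right hk (by linarith : 0 ≤ T)
    linarith
  have hL : ∑ n ∈ Finset.Ico 1 N,
      (Real.sqrt (2 * Real.pi) / 2 * Real.exp (-(1 + (n : ℝ) / N) ^ 2 / 2) - 3 * δ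
        - (Real.exp (-(1 + (n : ℝ) / N) ^ 2) + 2 * δ) / T)
      = Real.sqrt (2 * Real.pi) / 2 * ∑ n ∈ Finset.Ico 1 N, Real.exp (-(1 + (n : ℝ) / N) ^ 2 / 2)
        - (N - 1) * (3 * δ) - (∑ n ∈ Finset.Ico 1 N, Real.exp (-(1 + (n : ℝ) / N) ^ 2)
          + (N - 1) * (2 * δ)) / T := by
    rw [Finset.sum_sub_distrib, Finset.sum_sub_distrib, ← Finset.mul_sum, ← Finset.sum_div,
      Finset.sum_add_distrib]
    simp only [Finset.sum_const, Nat.card_Ico, nsmul_eq_mul]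
    rw [Nat.cast_sub (by omega)]
    push_cast
    ring
  rw [hL] at hsum
  set S := ∑ n ∈ Finset.Ico 1 N, Real.exp (-(1 + (n : ℝ) / N) ^ 2 / 2) with hS
  set Q := ∑ n ∈ Finset.Ico 1 N, Real.exp (-(1 + (n : ℝ) / N) ^ 2) with hQ
  have hQT : (Q + (N - 1) * (2 * δ)) / T ≤ q / (2 * Real.pi) + 0.00001 := by
    have : (Q + (N - 1) * (2 * δ)) ≤ N * q + 0.00002 := by nlinarith
    calc _ ≤ (N * q + 0.00002) / T := div_le_div_of_nonneg_right this (by linarith)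
      _ = q / (2 * Real.pi) + 0.00002 / T := by rw [hT]; field_simp
      _ ≤ _ := by
        have : 0.00002 / T ≤ 0.00001 := by
          rw [div_le_iff₀ (by linarith)]
          have : 2 ≤ T := by rw [hT]; nlinarith
          linarith
        linarith
  have hsd : 1 / (2 * Real.pi) * (-0.087) ≤ 1 / (2 * Real.pi) * (sT T 2 - sT T 1) :=
    mul_le_mul_of_nonneg_left hs (by positivity)
  have hmain : Real.sqrt (2 * Real.pi) / 2 * S - (0.0001 + (q + 0.087) / (2 * Real.pi)) ≤
      ∑ n ∈ Finset.Ico 1 N, (cT T (1 + n / N) - kT T (1 + n / N) / T)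
      + 1 / (2 * Real.pi) * (sT T 2 - sT T 1) := by
    have : (q + 0.087) / (2 * Real.pi) = q / (2 * Real.pi) - 1 / (2 * Real.pi) * (-0.087) := by ring
    rw [this]
    nlinarith
  have := mul_le_mul_of_nonneg_left hmain (by positivity : 0 ≤ 1 / (Real.pi * N))
  refine le_trans (le_of_eq ?_) this
  have hsq : Real.sqrt (2 * Real.pi) ^ 2 = 2 * Real.pi := Real.sq_sqrt (by positivity)
  have hsq0 : Real.sqrt (2 * Real.pi) ≠ 0 := by positivity
  have e1 : S / Real.sqrt (2 * Real.pi) = Real.sqrt (2 * Real.pi) / 2 * S / Real.pi := by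
    rw [div_eq_div_iff hsq0 (by positivity)]
    have : Real.sqrt (2 * Real.pi) / 2 * S * Real.sqrt (2 * Real.pi)
      = Real.sqrt (2 * Real.pi) ^ 2 * S / 2 := by ring
    rw [this, hsq]; ring
  rw [e1, ← sub_div]
  rw [one_div_mul_eq_div, one_div_mul_eq_div, div_div]

lemma VV_two : 0.06 ≤ VV 2 := by
  have hpi := Real.pi_gt_d2
  have hpi2 := Real.pi_lt_d2
  have hq : ∑ n ∈ Finset.Ico (1 : ℕ) 2, Real.exp (-(1 + (n : ℝ) / (2 : ℕ)) ^ 2) ≤ (2 : ℕ) * 0.0678 := by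
    simp
    have h2 := exp_neg_nat_le 2
    norm_num at h2 ⊢
    exact (Real.exp_le_exp.2 (by norm_num)).trans (h2.trans (by norm_num))
  have h := VV_lower 2 le_rfl 0.0678 hq
  refine le_trans ?_ h
  have hs := sqrt_two_pi_bounds
  simp
  have hE : 0.3246 ≤ Real.exp (-(1 + (2 : ℝ)⁻¹) ^ 2 / 2) := by
    have e : -(1 + (2 : ℝ)⁻¹) ^ 2 / 2 = -9 / 8 := by norm_num
    rw [e]
    exact exp_98
  have a1 : 0.1294 ≤ Real.exp (-(1 + (2 : ℝ)⁻¹) ^ 2 / 2) / (Real.sqrt 2 * Real.sqrt Real.pi) := by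
    have : Real.sqrt 2 * Real.sqrt Real.pi = Real.sqrt (2 * Real.pi) := by
      rw [Real.sqrt_mul (by norm_num)]
    rw [this, le_div_iff₀ (by linarith)]
    nlinarith [hs.2]
  have a2 : (0.0001 + (0.0678 + 0.087) / (2 * Real.pi)) / Real.pi ≤ 0.009 := by
    rw [div_le_iff₀ (by linarith)]
    have : (0.0678 + 0.087) / (2 * Real.pi) ≤ 0.025 := by
      rw [div_le_iff₀ (by linarith)]; linarith
    linarith
  norm_num at a1 a2 ⊢
  linarith

lemma VV_ge (N : ℕ) (hN : 2 ≤ N) : 0.135 - 0.175 / N ≤ VV N := by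
  have hN' : (2 : ℝ) ≤ N := by exact_mod_cast hN
  have hpi := Real.pi_gt_d2
  have hpi2 := Real.pi_lt_d2
  have hq : ∑ n ∈ Finset.Ico 1 N, Real.exp (-(1 + (n : ℝ) / N) ^ 2) ≤ N * 0.3679 := by
    have : ∑ n ∈ Finset.Ico 1 N, Real.exp (-(1 + (n : ℝ) / N) ^ 2)
        ≤ ∑ n ∈ Finset.Ico 1 N, (0.3679 : ℝ) := by
      apply Finset.sum_le_sum
      intro n _
      have h1 : 0 ≤ (n : ℝ) / N := by positivity
      have : Real.exp (-(1 + (n : ℝ) / N) ^ 2) ≤ Real.exp (-1) :=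
        Real.exp_le_exp.2 (by nlinarith)
      have := exp_neg_one_le
      linarith
    refine this.trans ?_
    simp only [Finset.sum_const, Nat.card_Ico, nsmul_eq_mul]
    rw [Nat.cast_sub (by omega)]
    push_cast
    linarith
  have h := VV_lower N hN 0.3679 hq
  refine le_trans ?_ h
  have hs := sqrt_two_pi_bounds
  have ht := trap_sum N (by omega)
  have hg := integral_gauss_12
  have e1 := exp_half_le
  have e2 := exp_two_bounds.2
  set S := ∑ n ∈ Finset.Ico 1 N, Real.exp (-(1 + (n : ℝ) / N) ^ 2 / 2) with hS
  have a0 : 0.3388 * N - 0.37095 ≤ S := by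
    have h3 : 0.3388 ≤ 1 / N * (S + 0.37095) := by
      refine (hg.trans ht).trans ?_
      apply mul_le_mul_of_nonneg_left _ (by positivity)
      linarith
    rw [one_div_mul_eq_div, le_div_iff₀ (by linarith)] at h3
    linarith
  have a1 : 0.135 * N - 0.1482 ≤ S / Real.sqrt (2 * Real.pi) := by
    rw [le_div_iff₀ (by linarith)]
    refine le_trans ?_ a0
    nlinarith [hs.1, hs.2]
  have a2 : (0.0001 + (0.3679 + 0.087) / (2 * Real.pi)) / Real.pi ≤ 0.0245 := by
    rw [div_le_iff₀ (by linarith)]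
    have : (0.3679 + 0.087) / (2 * Real.pi) ≤ 0.0728 := by
      rw [div_le_iff₀ (by linarith)]; linarith
    linarith
  rw [one_div_mul_eq_div, le_div_iff₀ (by linarith)]
  have : ((0.135 : ℝ) - 0.175 / N) * N = 0.135 * N - 0.175 := by field_simp
  rw [this]
  linarith


lemma selB_alt (N : ℕ) (t x : ℝ) : selB N t x =
    (1 / N) * ((1 - t / (2 * Real.pi * N)) * ∑ n ∈ Finset.Ico 1 N, Real.cos (t * (x - (1 + n / N)))
    + 1 / Real.pi * Real.sin (t / 2) * Real.cos (t * (x - 3 / 2))) := by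
  unfold selB
  have h : Real.sin (t * (x - 1)) - Real.sin (t * (x - 2))
      = 2 * Real.sin (t / 2) * Real.cos (t * (x - 3 / 2)) := by
    rw [Real.sin_sub_sin]
    congr 2
    · congr 1; congr 1; ring
    · ring
  rw [h]
  simp only [← sub_sub]
  ring

lemma cos_int_close (ν : Measure ℝ) [IsProbabilityMeasure ν] (t c : ℝ) :
    |∫ x, Real.cos (t * (x - c)) ∂ν - Real.exp (-t ^ 2 / 2) * Real.cos (t * (0 - c))|
      ≤ ‖charFun ν t - ((Real.exp (-t ^ 2 / 2) : ℝ) : ℂ)‖ := by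
  have hIntg : Integrable (fun x : ℝ => Complex.exp (t * x * Complex.I)) ν := by
    apply Integrable.of_bound (C := 1) (by apply Continuous.aestronglyMeasurable; fun_prop)
    refine Filter.Eventually.of_forall fun x => ?_
    have := Complex.norm_exp_ofReal_mul_I (t * x)
    push_cast at this
    exact this.le
  set w : ℂ := Complex.exp (((-(t * c) : ℝ) : ℂ) * Complex.I) with hw
  have e1 : ∫ x, Real.cos (t * (x - c)) ∂ν = (w * charFun ν t).re := by
    rw [charFun_apply_real, ← integral_const_mul]
    have := integral_re (hIntg.const_mul w)
    simp only [RCLike.re_eq_complex_re] at this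
    rw [← this]
    congr 1
    ext x
    rw [hw, ← Complex.exp_add]
    have : ((-(t * c) : ℝ) : ℂ) * Complex.I + t * x * Complex.I = ((t * (x - c) : ℝ) : ℂ) * Complex.I := by
      push_cast; ring
    rw [this, Complex.exp_ofReal_mul_I_re]
  have e2 : Real.exp (-t ^ 2 / 2) * Real.cos (t * (0 - c))
      = (w * ((Real.exp (-t ^ 2 / 2) : ℝ) : ℂ)).re := by
    rw [Complex.re_mul_ofReal, hw, Complex.exp_ofReal_mul_I_re, mul_comm]
    congr 2; ring
  rw [e1, e2, ← Complex.sub_re, ← mul_sub]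
  refine (Complex.abs_re_le_norm _).trans ?_
  rw [norm_mul, hw, Complex.norm_exp_ofReal_mul_I, one_mul]

lemma selB_int_lower (ν : Measure ℝ) [IsProbabilityMeasure ν] (N : ℕ) (hN : 1 ≤ N) (t : ℝ)
    (ht0 : 0 ≤ t) (htT : t ≤ 2 * Real.pi * N) :
    Real.exp (-t ^ 2 / 2) * selB N t 0 - ‖charFun ν t - ((Real.exp (-t ^ 2 / 2) : ℝ) : ℂ)‖
      ≤ ∫ x, selB N t x ∂ν := by
  have hN' : (1 : ℝ) ≤ N := by exact_mod_cast hN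
  have hpi := Real.pi_pos
  set D := ‖charFun ν t - ((Real.exp (-t ^ 2 / 2) : ℝ) : ℂ)‖ with hD
  have hD0 : 0 ≤ D := norm_nonneg _
  have hci : ∀ c : ℝ, Integrable (fun x : ℝ => Real.cos (t * (x - c))) ν := by
    intro c
    apply Integrable.of_bound (C := 1) (by apply Continuous.aestronglyMeasurable; fun_prop)
    exact Filter.Eventually.of_forall fun x => Real.abs_cos_le_one _
  set C : ℝ → ℝ := fun c => ∫ x, Real.cos (t * (x - c)) ∂ν with hC
  set C0 : ℝ → ℝ := fun c => Real.exp (-t ^ 2 / 2) * Real.cos (t * (0 - c)) with hC0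
  have hclose : ∀ c, |C c - C0 c| ≤ D := fun c => cos_int_close ν t c
  set r := t / (2 * Real.pi * N) with hr
  have hr0 : 0 ≤ r := by positivity
  have hr1 : r ≤ 1 := by rw [hr, div_le_one (by positivity)]; exact htT
  set s := 1 / Real.pi * Real.sin (t / 2) with hs
  have hsr : |s| ≤ N * r := by
    rw [hs, abs_mul, abs_of_pos (by positivity : 0 < 1 / Real.pi)]
    have h1 : |Real.sin (t / 2)| ≤ t / 2 := by
      have := Real.abs_sin_le_abs (x := t / 2)
      rwa [abs_of_nonneg (by positivity : 0 ≤ t / 2)] at this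
    calc _ ≤ 1 / Real.pi * (t / 2) := mul_le_mul_of_nonneg_left h1 (by positivity)
      _ = _ := by rw [hr]; field_simp
  have e1 : ∫ x, selB N t x ∂ν = (1 / N) * ((1 - r) * ∑ n ∈ Finset.Ico 1 N, C (1 + n / N)
      + s * C (3 / 2)) := by
    simp only [selB_alt]
    rw [integral_const_mul, integral_add, integral_const_mul, integral_const_mul,
      integral_finsetSum]
    · intro n _; exact hci _
    · exact (integrable_finsetSum _ fun n _ => hci _).const_mul _
    · exact (hci _).const_mul _
  have e2 : Real.exp (-t ^ 2 / 2) * selB N t 0 = (1 / N) * ((1 - r) * ∑ n ∈ Finset.Ico 1 N, C0 (1 + n / N)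
      + s * C0 (3 / 2)) := by
    rw [selB_alt]
    simp only [hC0, ← Finset.mul_sum]
    ring
  rw [e1, e2]
  have h1 : ∑ n ∈ Finset.Ico 1 N, C0 (1 + n / N) - (N - 1) * D ≤ ∑ n ∈ Finset.Ico 1 N, C (1 + n / N) := by
    have : ∑ n ∈ Finset.Ico 1 N, (C0 (1 + n / N) - D) ≤ ∑ n ∈ Finset.Ico 1 N, C (1 + n / N) := by
      apply Finset.sum_le_sum
      intro n _
      have := (abs_le.1 (hclose (1 + n / N))).1
      linarith
    rw [Finset.sum_sub_distrib] at this
    simp only [Finset.sum_const, Nat.card_Ico, nsmul_eq_mul] at this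
    rw [Nat.cast_sub hN] at this
    push_cast at this
    exact this
  have h2 : s * C0 (3 / 2) - N * r * D ≤ s * C (3 / 2) := by
    have : |s * (C (3 / 2) - C0 (3 / 2))| ≤ N * r * D := by
      rw [abs_mul]
      exact mul_le_mul hsr (hclose _) (abs_nonneg _) (by positivity)
    have := (abs_le.1 this).1
    linarith
  have h3 := mul_le_mul_of_nonneg_left h1 (by linarith : 0 ≤ 1 - r)
  have h4 : (1 - r) * ∑ n ∈ Finset.Ico 1 N, C0 (1 + n / N) + s * C0 (3 / 2) - N * D
      ≤ (1 - r) * ∑ n ∈ Finset.Ico 1 N, C (1 + n / N) + s * C (3 / 2) := by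
    nlinarith [mul_nonneg (by linarith : 0 ≤ 1 - r) hD0]
  have h5 := mul_le_mul_of_nonneg_left h4 (by positivity : (0 : ℝ) ≤ 1 / N)
  refine le_trans (le_of_eq ?_) h5
  field_simp

lemma prob_lower (ν : Measure ℝ) [IsProbabilityMeasure ν] (N : ℕ) (hN : 1 ≤ N) :
    VV N - 1 / Real.pi * ∫ t in (0 : ℝ)..(2 * Real.pi * N),
      ‖charFun ν t - ((Real.exp (-t ^ 2 / 2) : ℝ) : ℂ)‖ ≤ ν.real (Set.Icc 1 2) := by
  have hpi := Real.pi_pos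
  set T := 2 * Real.pi * N with hT
  have hT0 : 0 ≤ T := by positivity
  have hcont : Continuous (fun p : ℝ × ℝ => selB N p.1 p.2) := by
    unfold selB; fun_prop
  have hbound : ∃ B : ℝ, ∀ t ∈ Set.uIoc 0 T, ∀ x, |selB N t x| ≤ B := by
    refine ⟨|1 / (N : ℝ)| * ((1 + |T / (2 * Real.pi * N)|) * ∑ n ∈ Finset.Ico 1 N, (1 : ℝ)
      + |1 / (2 * Real.pi)| * (1 + 1)), ?_⟩
    intro t ht x
    rw [Set.uIoc_of_le hT0] at ht
    unfold selB
    rw [abs_mul]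
    apply mul_le_mul_of_nonneg_left _ (abs_nonneg _)
    refine (abs_add_le _ _).trans (add_le_add ?_ ?_)
    · rw [abs_mul]
      apply mul_le_mul _ _ (abs_nonneg _) (by positivity)
      · refine (abs_sub _ _).trans ?_
        rw [abs_one]
        gcongr
        exact div_nonneg (Set.mem_Ioc.1 ht).1.le (by positivity)
        exact ht.2
      · refine (Finset.abs_sum_le_sum_abs _ _).trans (Finset.sum_le_sum fun n _ => ?_)
        exact Real.abs_cos_le_one _
    · rw [abs_mul]
      apply mul_le_mul_of_nonneg_left _ (abs_nonneg _)
      exact (abs_sub _ _).trans (add_le_add (Real.abs_sin_le_one _) (Real.abs_sin_le_one _))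
  obtain ⟨B, hB⟩ := hbound
  have hIntg : Integrable (Function.uncurry (selB N)) ((volume.restrict (Set.uIoc 0 T)).prod ν) := by
    have : IsFiniteMeasure (volume.restrict (Set.uIoc 0 T)) := by
      rw [Set.uIoc_of_le hT0]; infer_instance
    apply Integrable.of_bound (C := B) hcont.aestronglyMeasurable
    have h := Measure.ae_prod_mem_iff_ae_ae_mem (μ := volume.restrict (Set.uIoc 0 T)) (ν := ν)
      (s := (Set.uIoc 0 T) ×ˢ (Set.univ : Set ℝ)) (measurableSet_uIoc.prod MeasurableSet.univ)
    have h2 : ∀ᵐ z ∂((volume.restrict (Set.uIoc 0 T)).prod ν), z ∈ (Set.uIoc 0 T) ×ˢ (Set.univ : Set ℝ) := by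
      rw [h]
      filter_upwards [ae_restrict_mem (μ := volume) (measurableSet_uIoc (a := (0 : ℝ)) (b := T))] with t ht
      exact Filter.Eventually.of_forall fun x => ⟨ht, trivial⟩
    filter_upwards [h2] with z hz
    exact hB z.1 hz.1 z.2
  have hswap := intervalIntegral_integral_swap hIntg
  have hup : 1 / Real.pi * ∫ t in (0 : ℝ)..T, ∫ x, selB N t x ∂ν ≤ ν.real (Set.Icc 1 2) := by
    rw [hswap, ← integral_const_mul]
    have h1 : ∫ x, Set.indicator (Set.Icc (1 : ℝ) 2) (fun _ => (1 : ℝ)) x ∂ν = ν.real (Set.Icc 1 2) := by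
      rw [integral_indicator measurableSet_Icc]; simp
    rw [← h1]
    apply integral_mono
    · apply Integrable.const_mul
      have := hIntg.integral_prod_right
      simpa [intervalIntegral.integral_of_le hT0, Set.uIoc_of_le hT0, Function.uncurry] using this
    · exact (integrable_const _).indicator measurableSet_Icc
    · intro x; exact selB_minorant N hN x
  have hlow : VV N - 1 / Real.pi * ∫ t in (0 : ℝ)..T,
      ‖charFun ν t - ((Real.exp (-t ^ 2 / 2) : ℝ) : ℂ)‖
      ≤ 1 / Real.pi * ∫ t in (0 : ℝ)..T, ∫ x, selB N t x ∂ν := by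
    have hc0 : Continuous fun t : ℝ => selB N t 0 :=
      hcont.comp (Continuous.prodMk continuous_id continuous_const)
    have hD : Continuous fun t : ℝ => ‖charFun ν t - ((Real.exp (-t ^ 2 / 2) : ℝ) : ℂ)‖ := by
      have := continuous_charFun (μ := ν)
      fun_prop
    have hE : Continuous fun t : ℝ => Real.exp (-t ^ 2 / 2) * selB N t 0 := by fun_prop
    unfold VV
    rw [← mul_sub, ← intervalIntegral.integral_sub (hE.intervalIntegrable _ _)
      (hD.intervalIntegrable _ _)]
    apply mul_le_mul_of_nonneg_left _ (by positivity)
    apply intervalIntegral.integral_mono_on hT0 ((hE.sub hD).intervalIntegrable _ _)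
    · have := hIntg.integral_prod_left
      rw [intervalIntegrable_iff]
      exact this
    · intro t ht
      exact selB_int_lower ν N hN t ht.1 ht.2
  exact hlow.trans hup


lemma final_arith (L J V : ℝ) (N : ℕ) (hL : 0 < L) (hN : 2 ≤ N) (hN1 : 4 * L * N ≤ 1)
    (hN2 : 1 < 4 * L * (N + 1)) (hL8 : L < 1 / 8)
    (hV2 : N = 2 → 0.06 ≤ V) (hV : 0.135 - 0.175 / N ≤ V)
    (hJ1 : J ≤ 0.28 * L) (hJ2 : L ≤ 0.1 → J ≤ 0.2 * L) (hJ3 : L ≤ 1 / 12 → J ≤ 0.19 * L) :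
    1 / 8 - L ≤ V - J := by
  rcases Nat.lt_or_ge 2 N with h | h
  · have hN3 : (3 : ℝ) ≤ N := by exact_mod_cast h
    have hL12 : L ≤ 1 / 12 := by nlinarith
    have hJ := hJ3 hL12
    have h1 : 1 / (4 * ((N : ℝ) + 1)) ≤ L := by
      rw [div_le_iff₀ (by positivity)]; nlinarith
    have h2 : (0.175 : ℝ) / N - 0.01 ≤ 0.81 * (1 / (4 * ((N : ℝ) + 1))) := by
      rw [← sub_nonneg]
      have : (0.81 : ℝ) * (1 / (4 * ((N : ℝ) + 1))) - (0.175 / N - 0.01)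
          = (0.2025 * N + 0.01 * N * (N + 1) - 0.175 * (N + 1)) / (N * (N + 1)) := by
        field_simp; ring
      rw [this]
      apply div_nonneg _ (by positivity)
      nlinarith
    linarith
  · have hN2' : N = 2 := le_antisymm h hN
    have hv := hV2 hN2'
    rw [hN2'] at hN2
    norm_num at hN2
    rcases le_or_gt L 0.1 with h' | h'
    · have := hJ2 h'
      norm_num at *
      linarith
    · norm_num at *
      linarith

lemma core_iid {Ω : Type*} [MeasurableSpace Ω]
    (P : Measure Ω) [IsProbabilityMeasure P] (n : ℕ) (hn : 0 < n)
    (Y : Fin n → Ω → ℝ) (hmeas : ∀ i, Measurable (Y i))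
    (hindep : iIndepFun Y P)
    (hident : ∀ i j, IdentDistrib (Y i) (Y j) P P)
    (β : ℝ)
    (hmom3 : ∀ i, Integrable (fun ω => |Y i ω| ^ 3) P)
    (hmean : ∀ i, ∫ ω, Y i ω ∂P = 0)
    (hvar : ∀ i, ∫ ω, (Y i ω) ^ 2 ∂P = 1)
    (hrho : ∀ i, ∫ ω, |Y i ω| ^ 3 ∂P = β) :
    1 / 8 - β / Real.sqrt n ≤
        P.real ((fun ω => (Real.sqrt n)⁻¹ * ∑ i, Y i ω) ⁻¹' Set.Icc 1 2) := by
  have hn' : (0 : ℝ) < n := by exact_mod_cast hn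
  have hs : 0 < Real.sqrt n := Real.sqrt_pos.2 hn'
  have hpi := Real.pi_pos
  let i0 : Fin n := ⟨0, hn⟩
  have hβ := one_le_third P (Y i0) (hmeas i0).aemeasurable β (hmom3 i0) (hvar i0) (hrho i0)
  set L := β / Real.sqrt n with hLdef
  have hL : 0 < L := by positivity
  have hLs : L * Real.sqrt n = β := by rw [hLdef]; field_simp
  rcases le_or_gt (1 / 8) L with hL8 | hL8
  · exact le_trans (by linarith) measureReal_nonneg
  set S : Ω → ℝ := fun ω => (Real.sqrt n)⁻¹ * ∑ i, Y i ω with hS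
  have hsum : Measurable (fun ω => ∑ i, Y i ω) := Finset.measurable_fun_sum _ fun i _ => hmeas i
  have hSm : Measurable S := hsum.const_mul _
  set ν := P.map S with hν
  have hνp : IsProbabilityMeasure ν := Measure.isProbabilityMeasure_map hSm.aemeasurable
  have hchar : ∀ t, charFun ν t = (charFun (P.map (Y i0)) ((Real.sqrt n)⁻¹ * t)) ^ n := by
    intro t
    rw [hν, hS, charFun_map_mul_comp hsum.aemeasurable,
      hindep.charFun_map_fun_sum_eq_prod fun i => (hmeas i).aemeasurable]
    simp [fun i => (hident i i0).map_eq]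
  set N := ⌊1 / (4 * L)⌋₊ with hNdef
  have hNle : (N : ℝ) ≤ 1 / (4 * L) := Nat.floor_le (by positivity)
  have hNlt : 1 / (4 * L) < N + 1 := Nat.lt_floor_add_one _
  have hN1 : 4 * L * N ≤ 1 := by
    rw [le_div_iff₀ (by positivity)] at hNle; linarith
  have hN2 : 1 < 4 * L * (N + 1) := by
    rw [div_lt_iff₀ (by positivity)] at hNlt; linarith
  have hN : 2 ≤ N := by
    apply Nat.le_floor
    rw [le_div_iff₀ (by positivity)]
    push_cast; linarith
  have hD : Continuous fun t : ℝ => ‖charFun ν t - ((Real.exp (-t ^ 2 / 2) : ℝ) : ℂ)‖ := by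
    have := continuous_charFun (μ := ν)
    fun_prop
  have hu : ∀ t : ℝ, (Real.sqrt n)⁻¹ * t * Real.sqrt n = t := fun t => by field_simp
  have htay : ∀ t : ℝ, 0 ≤ t → _ := fun t ht =>
    charFun_taylor3 P (Y i0) (hmeas i0).aemeasurable β (hmom3 i0) (hmean i0) (hvar i0) (hrho i0)
      ((Real.sqrt n)⁻¹ * t) (by positivity)
  obtain ⟨c1, c2, c3⟩ := D_int_cases _ hD L hL hL8.le (fun t => norm_nonneg _)
    (fun t ht hLt => by
      rw [hchar]
      exact char_diff_small _ n hn β L t _ hβ hLs (hu t) ht (htay t ht) hLt)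
    (fun t ht hLt hLt2 => by
      rw [hchar]
      exact char_diff_large _ n hn β L t _ hβ hLs (hu t) ht (htay t ht) hLt hLt2)
    (2 * Real.pi * N) (by positivity) (by nlinarith)
  have hp := prob_lower ν N (by omega)
  rw [hν, map_measureReal_apply hSm measurableSet_Icc] at hp
  refine le_trans ?_ hp
  have hmul : ∀ c I : ℝ, I ≤ Real.pi * c → 1 / Real.pi * I ≤ c := by
    intro c I h
    rw [one_div, inv_mul_le_iff₀ hpi]; exact h
  exact final_arith L _ _ N hL hN hN1 hN2 hL8 (fun h => by rw [h]; exact VV_two) (VV_ge N hN)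
    (hmul _ _ c1) (fun h => hmul _ _ (c2 h)) (fun h => hmul _ _ (c3 h))

lemma half_thm {Ω : Type*} [MeasurableSpace Ω]
    (P : Measure Ω) [IsProbabilityMeasure P] (n : ℕ) (hn : 0 < n)
    (X : Fin n → Ω → ℝ) (hmeas : ∀ i, Measurable (X i))
    (hindep : iIndepFun X P)
    (hident : ∀ i j, IdentDistrib (X i) (X j) P P)
    (μ σ τ ρ : ℝ) (hσ : 0 < σ) (hτ : |τ| = σ)
    (hmom3 : ∀ i, Integrable (fun ω => |X i ω - μ| ^ 3) P)
    (hmean : ∀ i, ∫ ω, X i ω ∂P = μ)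
    (hvar : ∀ i, ∫ ω, (X i ω - μ) ^ 2 ∂P = σ ^ 2)
    (hrho : ∀ i, ∫ ω, |X i ω - μ| ^ 3 ∂P = ρ) :
    1 / 8 - ρ / (σ ^ 3 * Real.sqrt n) ≤
        P.real ((fun ω => (Real.sqrt n)⁻¹ * ∑ i, (X i ω - μ) / τ) ⁻¹' Set.Icc 1 2) := by
  have hτ2 : τ ^ 2 = σ ^ 2 := by rw [← hτ, sq_abs]
  have hXm : ∀ i, Integrable (fun ω => X i ω - μ) P := fun i =>
    (integrable_of_third P _ ((hmeas i).sub_const μ).aemeasurable (hmom3 i)).1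
  have hg : Measurable (fun x : ℝ => (x - μ) / τ) := by fun_prop
  have e3 : ∀ i ω, |(X i ω - μ) / τ| ^ 3 = |X i ω - μ| ^ 3 / σ ^ 3 := by
    intro i ω
    rw [abs_div, hτ, div_pow]
  have := core_iid P n hn (fun i ω => (X i ω - μ) / τ) (fun i => hg.comp (hmeas i))
    (hindep.comp (fun _ x => (x - μ) / τ) fun _ => hg) (fun i j => (hident i j).comp hg)
    (ρ / σ ^ 3)
    (fun i => by simp only [e3]; exact (hmom3 i).div_const _)
    (fun i => by
      rw [integral_div]
      have hX : Integrable (X i) P := by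
        have := (hXm i).add (integrable_const μ)
        simpa [Pi.add_def] using this
      rw [integral_sub hX (integrable_const _), hmean]; simp)
    (fun i => by
      simp only [div_pow]
      rw [integral_div, hvar, hτ2]; field_simp)
    (fun i => by
      simp only [e3]
      rw [integral_div, hrho])
  rw [div_div] at this
  exact this


/-- if X_1,…,X_n are i.i.d. real random variables with mean μ, variance
σ² > 0 and third absolute central moment ρ = E|X_1 − μ|³ < ∞, and X = X_1+…+X_n, then
P[σ√n ≤ X − μn ≤ 2σ√n] ≥ 1/8 − ρ/(σ³√n) and
P[−2σ√n ≤ X − μn ≤ −σ√n] ≥ 1/8 − ρ/(σ³√n). -/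
theorem sum_iid_in_range_prob {Ω : Type*} [MeasurableSpace Ω]
    (P : Measure Ω) [IsProbabilityMeasure P] (n : ℕ) (hn : 0 < n)
    (X : Fin n → Ω → ℝ) (hmeas : ∀ i, Measurable (X i))
    (hindep : iIndepFun X P)
    (hident : ∀ i j, IdentDistrib (X i) (X j) P P)
    (μ σ ρ : ℝ) (hσ : 0 < σ)
    (hmom3 : ∀ i, Integrable (fun ω => |X i ω - μ| ^ 3) P)
    (hmean : ∀ i, ∫ ω, X i ω ∂P = μ)
    (hvar : ∀ i, ∫ ω, (X i ω - μ) ^ 2 ∂P = σ ^ 2)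
    (hrho : ∀ i, ∫ ω, |X i ω - μ| ^ 3 ∂P = ρ) :
    1 / 8 - ρ / (σ ^ 3 * Real.sqrt n) ≤
        (P {ω | σ * Real.sqrt n ≤ (∑ i, X i ω) - μ * n ∧
          (∑ i, X i ω) - μ * n ≤ 2 * σ * Real.sqrt n}).toReal ∧
      1 / 8 - ρ / (σ ^ 3 * Real.sqrt n) ≤
        (P {ω | -(2 * σ * Real.sqrt n) ≤ (∑ i, X i ω) - μ * n ∧
          (∑ i, X i ω) - μ * n ≤ -(σ * Real.sqrt n)}).toReal := by
  have hn' : (0 : ℝ) < n := by exact_mod_cast hn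
  have hs : 0 < Real.sqrt n := Real.sqrt_pos.2 hn'
  have hss : Real.sqrt n * Real.sqrt n = n := Real.mul_self_sqrt hn'.le
  have hσs : 0 < σ * Real.sqrt n := by positivity
  have hsum : ∀ (τ : ℝ) (ω : Ω), (Real.sqrt n)⁻¹ * ∑ i, (X i ω - μ) / τ
      = ((∑ i, X i ω) - μ * n) / (τ * Real.sqrt n) := by
    intro τ ω
    rw [← Finset.sum_div, Finset.sum_sub_distrib]
    simp only [Finset.sum_const, Finset.card_univ, Fintype.card_fin, nsmul_eq_mul]
    rw [mul_comm (n : ℝ) μ, mul_comm τ, ← div_div, inv_mul_eq_div, div_right_comm]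
  constructor
  · refine (half_thm P n hn X hmeas hindep hident μ σ σ ρ hσ (abs_of_pos hσ) hmom3 hmean hvar
      hrho).trans (le_of_eq ?_)
    rw [measureReal_def]
    congr 2
    ext ω
    simp only [Set.mem_preimage, Set.mem_Icc, Set.mem_ofPred_eq, hsum]
    rw [le_div_iff₀ hσs, div_le_iff₀ hσs, one_mul, mul_assoc]
  · refine (half_thm P n hn X hmeas hindep hident μ σ (-σ) ρ hσ (by rw [abs_neg, abs_of_pos hσ])
      hmom3 hmean hvar hrho).trans (le_of_eq ?_)
    rw [measureReal_def]
    congr 2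
    ext ω
    simp only [Set.mem_preimage, Set.mem_Icc, Set.mem_ofPred_eq, hsum]
    rw [neg_mul, div_neg, ← neg_div, le_div_iff₀ hσs, div_le_iff₀ hσs]
    constructor <;> rintro ⟨h1, h2⟩ <;> constructor <;> linarith
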